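/- For any R > 0 and α ∈ (0, π/2), let u be the unique entire solution emanating from the planar front in Ω = Ω_{R,α}, and assume u propagates completely. Then there exist τ > 0, τ₁ ∈ ℝ, z₁ ∈ ℝ, δ > 0 and μ > 0 such that, for all t ≥ τ₁ and all x ∈ Ω̄ with x₁ > 0 and |x| ≥ L, u(t,x) ≤ φ(|x| − c(t − τ₁ + τ) + ((N−1)/c) ln(t − τ₁ + τ) + z₁) + δ e^{−δ ϑ(t − τ₁)} + δ e^{−μ(|x| − L)}, where ϑ(s) = (2/3)(ln(s+1))^{3/2} for s ≥ 0. -/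

import Mathlib

open Set Filter Topology MeasureTheory

noncomputable section

/-- `ℝ^N` with `N = d+1`, Euclidean structure. -/
abbrev Euc (d : ℕ) := EuclideanSpace ℝ (Fin (d + 1))

/-- The Euclidean norm of `x' = (x₂,…,x_N)` for `x = (x₁,x') ∈ ℝ^N`. -/
def primeNorm {d : ℕ} (x : Euc d) : ℝ :=
  Real.sqrt (∑ i, if i = 0 then 0 else (x i) ^ 2)

/-- The funnel-shaped domain `Ω = {x : |x'| < h(x₁)}`. -/
def funnel (d : ℕ) (h : ℝ → ℝ) : Set (Euc d) := {x | primeNorm x < h (x 0)}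

/-- The Laplacian of `g` at `x`, computed with derivatives taken within the set `s`. -/
def lapW {d : ℕ} (s : Set (Euc d)) (g : Euc d → ℝ) (x : Euc d) : ℝ :=
  ∑ i, fderivWithin ℝ (fun y => fderivWithin ℝ g s y (EuclideanSpace.single i 1)) s x
      (EuclideanSpace.single i 1)

/-- The quantity `ν·∇g` at a boundary point `x` of the funnel domain `Ω_{R,α}`, where
`ν(x) = (1+h'(x₁)²)^{-1/2}·(-h'(x₁), x'/|x'|)` is the outward unit normal. -/
def neumannLHS {d : ℕ} (h : ℝ → ℝ) (g : Euc d → ℝ) (x : Euc d) : ℝ :=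
  (Real.sqrt (1 + deriv h (x 0) ^ 2))⁻¹ *
    (-(deriv h (x 0)) * fderivWithin ℝ g (closure (funnel d h)) x (EuclideanSpace.single 0 1)
      + ∑ i, if i = 0 then 0 else
          (x i / primeNorm x) *
            fderivWithin ℝ g (closure (funnel d h)) x (EuclideanSpace.single i 1))

/-- The bistable nonlinearity `f`, of class `C^{1,1}`, with positive mass, extended affinely
outside `[0,1]`. -/
structure Bistable (f : ℝ → ℝ) (θ : ℝ) : Prop where
  smooth : ContDiff ℝ 1 f
  lip_deriv : ∃ C : NNReal, LipschitzWith C (deriv f)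
  f0 : f 0 = 0
  f1 : f 1 = 0
  df0 : deriv f 0 < 0
  df1 : deriv f 1 < 0
  θmem : θ ∈ Ioo (0 : ℝ) 1
  neg : ∀ s ∈ Ioo (0 : ℝ) θ, f s < 0
  pos : ∀ s ∈ Ioo θ (1 : ℝ), 0 < f s
  dθ : 0 < deriv f θ
  mass : 0 < ∫ s in (0 : ℝ)..1, f s
  ext_neg : ∀ s < (0 : ℝ), f s = deriv f 0 * s
  ext_pos : ∀ s > (1 : ℝ), f s = deriv f 1 * (s - 1)

/-- The planar traveling front `φ(x₁ - ct)`: `φ'' + cφ' + f(φ) = 0`, `φ(-∞) = 1`,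
`φ(+∞) = 0`, `0 < φ < 1`, `φ` decreasing, normalized by `φ(0) = θ`, with speed `c > 0`. -/
structure PlanarFront (f : ℝ → ℝ) (θ c : ℝ) (φ : ℝ → ℝ) : Prop where
  cpos : 0 < c
  mem : ∀ z : ℝ, φ z ∈ Ioo (0 : ℝ) 1
  smooth : ContDiff ℝ 2 φ
  anti : StrictAnti φ
  ode : ∀ z : ℝ, deriv (deriv φ) z + c * deriv φ z + f (φ z) = 0
  lim_bot : Tendsto φ atBot (nhds 1)
  lim_top : Tendsto φ atTop (nhds 0)
  pin : φ 0 = θ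

/-- `h : ℝ → ℝ` defines a funnel-shaped domain `Ω_{R,α}` (of dimension `N = d+1 ≥ 2`) with
cylinder radius `R`, opening angle `α` and transition parameter `L`. -/
structure IsFunnel (d : ℕ) (R α L : ℝ) (h : ℝ → ℝ) : Prop where
  dpos : 1 ≤ d
  Rpos : 0 < R
  αmem : α ∈ Ico (0 : ℝ) (Real.pi / 2)
  RL : R < L
  smooth : ContDiff ℝ 2 h
  holder : ∃ β : NNReal, 0 < β ∧ (β : ℝ) < 1 ∧ ∃ C : NNReal, HolderWith C β (deriv (deriv h))
  deriv_nonneg : ∀ x : ℝ, 0 ≤ deriv h x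
  deriv_le : ∀ x : ℝ, deriv h x ≤ Real.tan α
  left : ∀ x ≤ (0 : ℝ), h x = R
  right : ∀ x : ℝ, L * Real.cos α ≤ x → h x = x * Real.tan α

/-- An entire solution of `u_t = Δu + f(u)` in `ℝ × Ω̄` (with values in `[0,1]`),
Neumann boundary condition `ν·∇u = 0` on `ℝ × ∂Ω`, emanating from the planar front
`φ(x₁ - ct)` as `t → -∞`. -/
structure IsEntireSolution (d : ℕ) (h f : ℝ → ℝ) (c : ℝ) (φ : ℝ → ℝ)
    (u : ℝ → Euc d → ℝ) : Prop where
  range01 : ∀ t : ℝ, ∀ x ∈ closure (funnel d h), u t x ∈ Icc (0 : ℝ) 1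
  time_diff : ∀ x ∈ closure (funnel d h), Differentiable ℝ fun t => u t x
  space_reg : ∀ t : ℝ, ContDiffOn ℝ 2 (u t) (closure (funnel d h))
  pde : ∀ t : ℝ, ∀ x ∈ closure (funnel d h),
      deriv (fun s => u s x) t = lapW (closure (funnel d h)) (u t) x + f (u t x)
  neumann : ∀ t : ℝ, ∀ x ∈ frontier (funnel d h), neumannLHS h (u t) x = 0
  past : ∀ ε > (0 : ℝ), ∃ T : ℝ, ∀ t ≤ T, ∀ x ∈ closure (funnel d h),
      |u t x - φ (x 0 - c * t)| ≤ ε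

/-- Complete propagation: `u(t,x) → 1` as `t → +∞` locally uniformly in `x ∈ Ω̄`. -/
def CompletePropagation (d : ℕ) (h : ℝ → ℝ) (u : ℝ → Euc d → ℝ) : Prop :=
  TendstoLocallyUniformlyOn u (fun _ => (1 : ℝ)) atTop (closure (funnel d h))

/-- Blocking: `u(t,·)` converges uniformly on `Ω̄`, as `t → +∞`, to a stationary solution
`u_∞` with `u_∞(x) → 0` as `x₁ → +∞`. -/
def Blocked (d : ℕ) (h f : ℝ → ℝ) (u : ℝ → Euc d → ℝ) : Prop :=
  ∃ uinf : Euc d → ℝ,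
    TendstoUniformlyOn u uinf atTop (closure (funnel d h)) ∧
    ContDiffOn ℝ 2 uinf (closure (funnel d h)) ∧
    (∀ x ∈ closure (funnel d h), lapW (closure (funnel d h)) uinf x + f (uinf x) = 0) ∧
    (∀ x ∈ frontier (funnel d h), neumannLHS h uinf x = 0) ∧
    (∀ ε > (0 : ℝ), ∃ A : ℝ, ∀ x ∈ closure (funnel d h), A ≤ x 0 → |uinf x| ≤ ε)

/-- Stability of a solution `U` of `ΔU + f(U) = 0` on `s̄`:
`∫_s (|∇ψ|² - f'(U)ψ²) ≥ 0` for all compactly supported `C¹` functions `ψ`. -/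
def StableOn {d : ℕ} (s : Set (Euc d)) (f : ℝ → ℝ) (U : Euc d → ℝ) : Prop :=
  ∀ ψ : Euc d → ℝ, ContDiff ℝ 1 ψ → HasCompactSupport ψ →
    0 ≤ ∫ x in s, (‖gradient ψ x‖ ^ 2 - deriv f (U x) * ψ x ^ 2)

/-- The function `ϑ(s) = (2/3)·(ln(s+1))^{3/2}`. -/
def varTheta (s : ℝ) : ℝ := (2 / 3) * Real.log (s + 1) ^ ((3 : ℝ) / 2)

/-- The `i`-th vector of the standard basis. -/
abbrev stdVec {d : ℕ} (i : Fin (d + 1)) : Euc d := EuclideanSpace.single i (1 : ℝ)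

/-- The Laplacian, as the trace of the second derivative. -/
def lap {d : ℕ} (g : Euc d → ℝ) (x : Euc d) : ℝ :=
  ∑ i, fderiv ℝ (fun y => fderiv ℝ g y (stdVec i)) x (stdVec i)

lemma lap_congr {d : ℕ} {g g' : Euc d → ℝ} {x : Euc d} (hg : g =ᶠ[𝓝 x] g') :
    lap g x = lap g' x := by
  unfold lap
  refine Finset.sum_congr rfl fun i _ => ?_
  have : (fun y => fderiv ℝ g y (stdVec i)) =ᶠ[𝓝 x] fun y => fderiv ℝ g' y (stdVec i) := by
    filter_upwards [hg.eventuallyEq_nhds] with y hy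
    rw [hy.fderiv_eq]
  rw [this.fderiv_eq]

lemma lapW_eq_lap {d : ℕ} {s : Set (Euc d)} {x : Euc d} (hs : s ∈ 𝓝 x) (g : Euc d → ℝ) :
    lapW s g x = lap g x := by
  unfold lapW lap
  refine Finset.sum_congr rfl fun i _ => ?_
  rw [fderivWithin_of_mem_nhds hs]
  have : (fun y => fderivWithin ℝ g s y (EuclideanSpace.single i 1)) =ᶠ[𝓝 x]
      fun y => fderiv ℝ g y (stdVec i) := by
    filter_upwards [eventually_mem_nhds_iff.2 hs] with y hy
    rw [fderivWithin_of_mem_nhds hy]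
  rw [this.fderiv_eq]

lemma ContDiffAt.eventually_differentiableAt {d : ℕ} {g : Euc d → ℝ} {x : Euc d}
    (hg : ContDiffAt ℝ 2 g x) : ∀ᶠ y in 𝓝 x, DifferentiableAt ℝ g y := by
  filter_upwards [hg.eventually (by simp)] with y hy
  exact hy.differentiableAt (by simp)

lemma ContDiffAt.differentiableAt_partial {d : ℕ} {g : Euc d → ℝ} {x : Euc d}
    (hg : ContDiffAt ℝ 2 g x) (v : Euc d) :
    DifferentiableAt ℝ (fun y => fderiv ℝ g y v) x := by
  have h1 : ContDiffAt ℝ 1 (fderiv ℝ g) x := hg.fderiv_right (by norm_num)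
  exact (h1.differentiableAt (by simp)).clm_apply (differentiableAt_const v)

lemma lap_add {d : ℕ} {g k : Euc d → ℝ} {x : Euc d} (hg : ContDiffAt ℝ 2 g x)
    (hk : ContDiffAt ℝ 2 k x) : lap (fun y => g y + k y) x = lap g x + lap k x := by
  unfold lap
  rw [← Finset.sum_add_distrib]
  refine Finset.sum_congr rfl fun i _ => ?_
  have : (fun y => fderiv ℝ (fun y => g y + k y) y (stdVec i)) =ᶠ[𝓝 x]
      fun y => fderiv ℝ g y (stdVec i) + fderiv ℝ k y (stdVec i) := by
    filter_upwards [hg.eventually_differentiableAt, hk.eventually_differentiableAt] with y h1 h2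
    rw [fderiv_fun_add h1 h2]; rfl
  rw [this.fderiv_eq, fderiv_fun_add (hg.differentiableAt_partial _) (hk.differentiableAt_partial _)]
  rfl

lemma lap_const_mul {d : ℕ} {g : Euc d → ℝ} {x : Euc d} (a : ℝ) (hg : ContDiffAt ℝ 2 g x) :
    lap (fun y => a * g y) x = a * lap g x := by
  unfold lap
  rw [Finset.mul_sum]
  refine Finset.sum_congr rfl fun i _ => ?_
  have : (fun y => fderiv ℝ (fun y => a * g y) y (stdVec i)) =ᶠ[𝓝 x]
      fun y => a * fderiv ℝ g y (stdVec i) := by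
    filter_upwards [hg.eventually_differentiableAt] with y h1
    rw [fderiv_const_mul h1]; rfl
  rw [this.fderiv_eq, fderiv_const_mul (hg.differentiableAt_partial _)]
  rfl

lemma lap_sub {d : ℕ} {g k : Euc d → ℝ} {x : Euc d} (hg : ContDiffAt ℝ 2 g x)
    (hk : ContDiffAt ℝ 2 k x) : lap (fun y => g y - k y) x = lap g x - lap k x := by
  have h := lap_add hg (k := fun y => (-1) * k y) (contDiffAt_const.mul hk)
  rw [lap_const_mul _ hk] at h
  have e : (fun y => g y - k y) = fun y => g y + (-1) * k y := by funext y; ring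
  rw [e, h]; ring

lemma lap_const {d : ℕ} (a : ℝ) (x : Euc d) : lap (fun _ => a) x = 0 := by
  simp [lap]

/-- Chain rule for the Laplacian of a composition. -/
lemma lap_comp {d : ℕ} {Φ : ℝ → ℝ} {g : Euc d → ℝ} {x : Euc d} (hg : ContDiffAt ℝ 2 g x)
    (hΦ : ContDiffAt ℝ 2 Φ (g x)) :
    lap (fun y => Φ (g y)) x = deriv Φ (g x) * lap g x +
      deriv (deriv Φ) (g x) * ∑ i, (fderiv ℝ g x (stdVec i)) ^ 2 := by
  unfold lap
  rw [Finset.mul_sum, Finset.mul_sum, ← Finset.sum_add_distrib]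
  refine Finset.sum_congr rfl fun i _ => ?_
  have hΦe : ∀ᶠ z in 𝓝 (g x), DifferentiableAt ℝ Φ z := by
    filter_upwards [hΦ.eventually (by simp)] with y hy
    exact hy.differentiableAt (by simp)
  have : (fun y => fderiv ℝ (fun y => Φ (g y)) y (stdVec i)) =ᶠ[𝓝 x]
      fun y => deriv Φ (g y) * fderiv ℝ g y (stdVec i) := by
    filter_upwards [hg.eventually_differentiableAt, hg.continuousAt.eventually hΦe] with y h1 h2
    have := (h2.hasDerivAt.comp_hasFDerivAt y h1.hasFDerivAt).fderiv
    have e : (fun y => Φ (g y)) = Φ ∘ g := rfl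
    rw [e, this]; simp
  rw [this.fderiv_eq]
  have hdΦ : DifferentiableAt ℝ (deriv Φ) (g x) := by
    have h2 : ContDiffAt ℝ 1 (fderiv ℝ Φ) (g x) := hΦ.fderiv_right (by norm_num)
    have h3 := (h2.differentiableAt (by simp)).clm_apply (differentiableAt_const (1 : ℝ))
    exact h3
  have h1 : HasFDerivAt (fun y => deriv Φ (g y)) (deriv (deriv Φ) (g x) • fderiv ℝ g x) x :=
    hdΦ.hasDerivAt.comp_hasFDerivAt x (hg.differentiableAt (by simp)).hasFDerivAt
  have h2 := (hg.differentiableAt_partial (stdVec i)).hasFDerivAt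
  rw [(h1.fun_mul h2).fderiv]
  simp
  ring

lemma hasFDerivAt_norm_sq' {d : ℕ} (x : Euc d) (v : Euc d) :
    fderiv ℝ (fun y : Euc d => ‖y‖ ^ 2) x v = 2 * inner ℝ x v := by
  have := (hasStrictFDerivAt_norm_sq x).hasFDerivAt.fderiv
  rw [this]; simp

lemma inner_stdVec {d : ℕ} (x : Euc d) (i : Fin (d + 1)) : inner ℝ x (stdVec i) = x i := by
  simp [stdVec, EuclideanSpace.inner_single_right]

lemma norm_sq_eq_sum {d : ℕ} (x : Euc d) : ∑ i, (x i) ^ 2 = ‖x‖ ^ 2 := by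
  rw [EuclideanSpace.norm_sq_eq]; simp

lemma lap_norm_sq {d : ℕ} (x : Euc d) :
    lap (fun y : Euc d => ‖y‖ ^ 2) x = 2 * (d + 1) := by
  unfold lap
  have : ∀ i : Fin (d + 1), fderiv ℝ (fun y : Euc d =>
      fderiv ℝ (fun y : Euc d => ‖y‖ ^ 2) y (stdVec i)) x (stdVec i) = 2 := by
    intro i
    have e : (fun y : Euc d => fderiv ℝ (fun y : Euc d => ‖y‖ ^ 2) y (stdVec i)) =
        fun y => 2 * (EuclideanSpace.proj i : Euc d →L[ℝ] ℝ) y := by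
      funext y
      rw [hasFDerivAt_norm_sq', inner_stdVec]; rfl
    rw [e, fderiv_const_mul (ContinuousLinearMap.differentiableAt _), ContinuousLinearMap.fderiv]
    simp
  rw [Finset.sum_congr rfl fun i _ => this i]
  simp
  ring

lemma lap_coord {d : ℕ} (x : Euc d) (j : Fin (d + 1)) : lap (fun y : Euc d => y j) x = 0 := by
  have : (fun y : Euc d => y j) = (EuclideanSpace.proj j : Euc d →L[ℝ] ℝ) := by
    funext y; rfl
  rw [this]
  unfold lap
  simp only [ContinuousLinearMap.fderiv]
  simp

lemma contDiffAt_norm_sq {d : ℕ} (x : Euc d) : ContDiffAt ℝ 2 (fun y : Euc d => ‖y‖ ^ 2) x :=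
  (contDiff_norm_sq ℝ).contDiffAt

lemma contDiffAt_norm' {d : ℕ} {x : Euc d} (hx : x ≠ 0) :
    ContDiffAt ℝ 2 (fun y : Euc d => ‖y‖) x := contDiffAt_norm ℝ hx

lemma fderiv_norm_apply {d : ℕ} {x : Euc d} (hx : x ≠ 0) (v : Euc d) :
    fderiv ℝ (fun y : Euc d => ‖y‖) x v = inner ℝ x v / ‖x‖ := by
  have h0 : ‖x‖ ≠ 0 := norm_ne_zero_iff.2 hx
  have h1 := ((contDiffAt_norm' hx).differentiableAt (by simp)).hasFDerivAt
  have h2 := (h1.pow 2).fderiv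
  have h3 := hasFDerivAt_norm_sq' x v
  rw [h2] at h3
  simp at h3
  field_simp
  linarith

lemma sum_fderiv_norm_sq {d : ℕ} {x : Euc d} (hx : x ≠ 0) :
    ∑ i, (fderiv ℝ (fun y : Euc d => ‖y‖) x (stdVec i)) ^ 2 = 1 := by
  have h0 : ‖x‖ ≠ 0 := norm_ne_zero_iff.2 hx
  simp_rw [fderiv_norm_apply hx, inner_stdVec, div_pow]
  rw [← Finset.sum_div, norm_sq_eq_sum]
  field_simp

lemma lap_norm {d : ℕ} {x : Euc d} (hx : x ≠ 0) :
    lap (fun y : Euc d => ‖y‖) x = d / ‖x‖ := by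
  have h0 : ‖x‖ ≠ 0 := norm_ne_zero_iff.2 hx
  have h := lap_comp (Φ := fun s : ℝ => s ^ 2) (contDiffAt_norm' hx) (by fun_prop)
  rw [sum_fderiv_norm_sq hx, lap_norm_sq] at h
  have e1 : deriv (fun s : ℝ => s ^ 2) = fun s => 2 * s := by
    funext s; simp
  rw [e1] at h
  have e2 : deriv (fun s : ℝ => 2 * s) ‖x‖ = 2 := by
    simp
  rw [e2] at h
  field_simp
  linarith

/-- The Laplacian of a radial function. -/
lemma lap_radial {d : ℕ} {F : ℝ → ℝ} {x : Euc d} (hx : x ≠ 0) (hF : ContDiffAt ℝ 2 F ‖x‖) :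
    lap (fun y : Euc d => F ‖y‖) x = deriv (deriv F) ‖x‖ + d / ‖x‖ * deriv F ‖x‖ := by
  rw [lap_comp (contDiffAt_norm' hx) hF, lap_norm hx, sum_fderiv_norm_sq hx]
  ring

/-- The cube of the positive part. -/
def cubePos (s : ℝ) : ℝ := (max s 0) ^ 3

lemma hasDerivAt_max_pow {n : ℕ} (s : ℝ) :
    HasDerivAt (fun s : ℝ => (max s 0) ^ (n + 2)) ((n + 2) * (max s 0) ^ (n + 1)) s := by
  rcases lt_trichotomy s 0 with h | h | h
  · have : (fun s : ℝ => (max s 0) ^ (n + 2)) =ᶠ[𝓝 s] fun _ => 0 := by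
      filter_upwards [Iio_mem_nhds h] with y hy
      rw [max_eq_right (le_of_lt hy)]; simp
    rw [max_eq_right h.le]
    simpa using (hasDerivAt_const s (0 : ℝ)).congr_of_eventuallyEq this
  · subst h
    simp only [max_self]
    rw [hasDerivAt_iff_isLittleO_nhds_zero]
    simp only [zero_add, max_self]
    have : (fun h : ℝ => h ^ (n + 2)) =o[𝓝 0] fun h => h := by
      simpa using (Asymptotics.isLittleO_pow_pow (𝕜 := ℝ) (m := 1) (n := n + 2) (by omega))
    refine Asymptotics.IsBigO.trans_isLittleO ?_ this
    refine Asymptotics.IsBigO.of_bound 1 (Eventually.of_forall fun h => ?_)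
    simp only [ne_eq, Nat.add_eq_zero_iff, OfNat.ofNat_ne_zero, and_false, not_false_eq_true,
      zero_pow, one_ne_zero, mul_zero, sub_zero, smul_eq_mul, norm_pow, one_mul]
    gcongr
    rw [Real.norm_eq_abs, Real.norm_eq_abs, abs_of_nonneg (le_max_right h 0)]
    exact max_le (le_abs_self h) (abs_nonneg h)
  · have : (fun s : ℝ => (max s 0) ^ (n + 2)) =ᶠ[𝓝 s] fun y => y ^ (n + 2) := by
      filter_upwards [Ioi_mem_nhds h] with y hy
      rw [max_eq_left (le_of_lt hy)]
    rw [max_eq_left h.le]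
    have h2 := (hasDerivAt_pow (n + 2) s).congr_of_eventuallyEq this
    simpa using h2

lemma hasDerivAt_cubePos (s : ℝ) : HasDerivAt cubePos (3 * (max s 0) ^ 2) s := by
  have := hasDerivAt_max_pow (n := 1) s
  norm_num at this
  exact this

lemma deriv_cubePos : deriv cubePos = fun s => 3 * (max s 0) ^ 2 :=
  funext fun s => (hasDerivAt_cubePos s).deriv

lemma hasDerivAt_deriv_cubePos (s : ℝ) : HasDerivAt (deriv cubePos) (6 * max s 0) s := by
  rw [deriv_cubePos]
  have := (hasDerivAt_max_pow (n := 0) s).const_mul 3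
  refine this.congr_deriv ?_
  norm_num
  ring

lemma contDiff_sqPos : ContDiff ℝ 1 (fun s : ℝ => (max s 0) ^ 2) := by
  rw [contDiff_one_iff_deriv]
  have h := fun s : ℝ => hasDerivAt_max_pow (n := 0) s
  norm_num at h
  refine ⟨fun s => (h s).differentiableAt, ?_⟩
  have : deriv (fun s : ℝ => (max s 0) ^ 2) = fun s => 2 * max s 0 := funext fun s => (h s).deriv
  rw [this]
  fun_prop

lemma contDiff_cubePos : ContDiff ℝ 2 cubePos := by
  have : (2 : WithTop ℕ∞) = 1 + 1 := by norm_num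
  rw [this, contDiff_succ_iff_deriv]
  refine ⟨fun s => (hasDerivAt_cubePos s).differentiableAt, by simp, ?_⟩
  rw [deriv_cubePos]
  exact contDiff_const.mul contDiff_sqPos

lemma deriv2_nonpos_of_isLocalMax {g : ℝ → ℝ} {a : ℝ} (h : IsLocalMax g a)
    (hc : ContinuousAt g a) : deriv (deriv g) a ≤ 0 := by
  by_contra hcon
  push Not at hcon
  have hd := h.deriv_eq_zero
  have hmin := isLocalMin_of_deriv_deriv_pos hcon hd hc
  have : g =ᶠ[𝓝 a] fun _ => g a := by
    filter_upwards [h, hmin] with y h1 h2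
    exact le_antisymm h1 h2
  have h2 : deriv g =ᶠ[𝓝 a] fun _ => 0 := by
    filter_upwards [this.eventuallyEq_nhds] with y hy
    rw [hy.deriv_eq]; simp
  rw [h2.deriv_eq] at hcon
  simp at hcon

lemma lap_nonpos_of_isLocalMax {d : ℕ} {g : Euc d → ℝ} {x : Euc d} (hg : ContDiffAt ℝ 2 g x)
    (h : IsLocalMax g x) : lap g x ≤ 0 := by
  unfold lap
  refine Finset.sum_nonpos fun i _ => ?_
  have hline : ∀ s : ℝ, HasDerivAt (fun s : ℝ => x + s • stdVec i) (stdVec i) s := by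
    intro s
    simpa using ((hasDerivAt_id s).smul_const (stdVec i)).const_add x
  have hl0 : Tendsto (fun s : ℝ => x + s • stdVec (d := d) i) (𝓝 0) (𝓝 x) := by
    have := (hline 0).continuousAt.tendsto
    simpa using this
  have hmax : IsLocalMax (fun s : ℝ => g (x + s • stdVec i)) 0 := by
    have := hl0.eventually h
    simpa [IsLocalMax, IsMaxFilter] using this
  have hcont : ContinuousAt (fun s : ℝ => g (x + s • stdVec i)) 0 := by
    have : ContinuousAt g (x + (0 : ℝ) • stdVec i) := by simpa using hg.continuousAt
    exact ContinuousAt.comp (f := fun s : ℝ => x + s • stdVec i) this (hline 0).continuousAt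
  have h2 := deriv2_nonpos_of_isLocalMax hmax hcont
  have e1 : deriv (fun s : ℝ => g (x + s • stdVec i)) =ᶠ[𝓝 0]
      fun s => fderiv ℝ g (x + s • stdVec i) (stdVec i) := by
    filter_upwards [hl0.eventually hg.eventually_differentiableAt] with s hs
    exact (hs.hasFDerivAt.comp_hasDerivAt s (hline s)).deriv
  rw [e1.deriv_eq] at h2
  have h3 : HasFDerivAt (fun y => fderiv ℝ g y (stdVec i))
      (fderiv ℝ (fun y => fderiv ℝ g y (stdVec i)) x) (x + (0 : ℝ) • stdVec i) := by
    simpa using (hg.differentiableAt_partial (stdVec i)).hasFDerivAt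
  have h4 := (h3.comp_hasDerivAt (0 : ℝ) (hline 0)).deriv
  rw [← h4]
  exact h2

lemma primeNorm_nonneg {d : ℕ} (x : Euc d) : 0 ≤ primeNorm x := Real.sqrt_nonneg _

lemma primeNorm_sq {d : ℕ} (x : Euc d) : primeNorm x ^ 2 = ‖x‖ ^ 2 - (x 0) ^ 2 := by
  have h : ∑ i, (if i = 0 then 0 else (x i) ^ 2) = ‖x‖ ^ 2 - (x 0) ^ 2 := by
    rw [← norm_sq_eq_sum, Fin.sum_univ_succ, Fin.sum_univ_succ]
    simp
  unfold primeNorm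
  rw [Real.sq_sqrt, h]
  refine Finset.sum_nonneg fun i _ => ?_
  split_ifs
  · exact le_rfl
  · positivity

lemma primeNorm_eq_norm {d : ℕ} (x : Euc d) : primeNorm x = ‖x - x 0 • stdVec 0‖ := by
  have h : primeNorm x ^ 2 = ‖x - x 0 • stdVec 0‖ ^ 2 := by
    rw [primeNorm_sq, norm_sub_sq_real, inner_smul_right, inner_stdVec, norm_smul]
    simp [stdVec]
    ring
  exact (pow_left_inj₀ (primeNorm_nonneg x) (norm_nonneg _) two_ne_zero).1 h

lemma continuous_primeNorm {d : ℕ} : Continuous (primeNorm : Euc d → ℝ) := by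
  have : (primeNorm : Euc d → ℝ) = fun x => ‖x - x 0 • stdVec 0‖ := funext primeNorm_eq_norm
  rw [this]
  fun_prop

/-- The closed circular cone of slope `T` around the first axis. -/
def cone (d : ℕ) (T : ℝ) : Set (Euc d) := {x | primeNorm x ≤ x 0 * T}

/-- The open circular cone of slope `T` around the first axis. -/
def coneInt (d : ℕ) (T : ℝ) : Set (Euc d) := {x | primeNorm x < x 0 * T}

/-- A quadratic form that is positive inside the cone and vanishes on its boundary. -/
def rho {d : ℕ} (T : ℝ) (x : Euc d) : ℝ := (T ^ 2 + 1) * (x 0) ^ 2 - ‖x‖ ^ 2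

/-- The gradient of `rho`. -/
def gradRho {d : ℕ} (T : ℝ) (x : Euc d) : Euc d := (2 * (T ^ 2 + 1) * x 0) • stdVec 0 - (2 : ℝ) • x

lemma rho_eq {d : ℕ} (T : ℝ) (x : Euc d) : rho T x = T ^ 2 * (x 0) ^ 2 - primeNorm x ^ 2 := by
  rw [primeNorm_sq, rho]; ring

lemma mem_cone_iff {d : ℕ} {T : ℝ} (hT : 0 < T) {x : Euc d} :
    x ∈ cone d T ↔ 0 ≤ x 0 ∧ 0 ≤ rho T x := by
  have h0 := primeNorm_nonneg x
  rw [rho_eq]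
  simp only [cone, mem_ofPred_eq]
  constructor
  · intro h
    have h1 : 0 ≤ x 0 * T := h0.trans h
    exact ⟨nonneg_of_mul_nonneg_left h1 hT, by nlinarith⟩
  · rintro ⟨h1, h2⟩
    exact abs_le_of_sq_le_sq' (by nlinarith) (by positivity) |>.2

lemma mem_coneInt_iff {d : ℕ} {T : ℝ} (hT : 0 < T) {x : Euc d} :
    x ∈ coneInt d T ↔ 0 ≤ x 0 ∧ 0 < rho T x := by
  have h0 := primeNorm_nonneg x
  rw [rho_eq]
  simp only [coneInt, mem_ofPred_eq]
  constructor
  · intro h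
    have h1 : 0 ≤ x 0 * T := h0.trans h.le
    exact ⟨nonneg_of_mul_nonneg_left h1 hT, by nlinarith⟩
  · rintro ⟨h1, h2⟩
    exact abs_lt_of_sq_lt_sq' (by nlinarith) (by positivity) |>.2

lemma coneInt_subset_cone {d : ℕ} {T : ℝ} : coneInt d T ⊆ cone d T := by
  intro x hx
  simp only [cone, coneInt, mem_ofPred_eq] at *
  exact hx.le

lemma rho_eq_zero_of_mem_of_notMem {d : ℕ} {T : ℝ} (hT : 0 < T) {x : Euc d} (hx : x ∈ cone d T)
    (hx' : x ∉ coneInt d T) : rho T x = 0 := by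
  rw [mem_cone_iff hT] at hx
  rw [mem_coneInt_iff hT] at hx'
  refine le_antisymm (not_lt.1 fun h => hx' ⟨hx.1, h⟩) hx.2

lemma isClosed_cone {d : ℕ} {T : ℝ} : IsClosed (cone d T) :=
  isClosed_le continuous_primeNorm (by fun_prop)

lemma isOpen_coneInt {d : ℕ} {T : ℝ} : IsOpen (coneInt d T) :=
  isOpen_lt continuous_primeNorm (by fun_prop)

lemma convex_cone {d : ℕ} {T : ℝ} : Convex ℝ (cone d T) := by
  intro x hx y hy a b ha hb _
  simp only [cone, mem_ofPred_eq, primeNorm_eq_norm] at *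
  have e : (a • x + b • y) - (a • x + b • y) 0 • stdVec (d := d) 0 =
      a • (x - x 0 • stdVec 0) + b • (y - y 0 • stdVec 0) := by
    simp only [PiLp.add_apply, PiLp.smul_apply, smul_eq_mul]
    module
  rw [e]
  refine (norm_add_le _ _).trans ?_
  rw [norm_smul, norm_smul, Real.norm_of_nonneg ha, Real.norm_of_nonneg hb]
  simp only [PiLp.add_apply, PiLp.smul_apply, smul_eq_mul]
  nlinarith

lemma primeNorm_add_smul {d : ℕ} (x : Euc d) (s : ℝ) : primeNorm (x + s • stdVec 0) = primeNorm x := by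
  rw [primeNorm_eq_norm, primeNorm_eq_norm]
  congr 1
  simp only [PiLp.add_apply, PiLp.smul_apply, smul_eq_mul]
  simp [stdVec]
  module

lemma cone_subset_closure {d : ℕ} {T : ℝ} (hT : 0 < T) : cone d T ⊆ closure (coneInt d T) := by
  intro x hx
  have hlim : Tendsto (fun s : ℝ => x + s • stdVec (d := d) 0) (𝓝[>] 0) (𝓝 x) := by
    have : Continuous fun s : ℝ => x + s • stdVec (d := d) 0 := by fun_prop
    have h2 := this.tendsto 0
    simp only [zero_smul, add_zero] at h2
    exact h2.mono_left nhdsWithin_le_nhds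
  refine mem_closure_of_tendsto hlim ?_
  filter_upwards [self_mem_nhdsWithin] with s hs
  have hs' : (0 : ℝ) < s := hs
  simp only [cone, coneInt, mem_ofPred_eq, primeNorm_add_smul] at *
  simp [stdVec]
  nlinarith

lemma uniqueDiffOn_cone {d : ℕ} {T : ℝ} (hT : 0 < T) : UniqueDiffOn ℝ (cone d T) := by
  refine uniqueDiffOn_convex convex_cone ⟨stdVec 0, ?_⟩
  refine interior_mono coneInt_subset_cone ?_
  rw [isOpen_coneInt.interior_eq]
  have := primeNorm_add_smul (d := d) 0 1
  simp only [coneInt, mem_ofPred_eq]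
  simp only [zero_add, one_smul] at this
  rw [this]
  have h0 : primeNorm (0 : Euc d) = 0 := by simp [primeNorm]
  rw [h0]
  simpa [stdVec] using hT

lemma cone_mem_nhds {d : ℕ} {T : ℝ} {x : Euc d} (hx : x ∈ coneInt d T) : cone d T ∈ 𝓝 x :=
  mem_of_superset (isOpen_coneInt.mem_nhds hx) coneInt_subset_cone

lemma pos_of_mem_cone {d : ℕ} {T : ℝ} (hT : 0 < T) {x : Euc d} (hx : x ∈ cone d T)
    (h0 : x ≠ 0) : 0 < x 0 := by
  rw [mem_cone_iff hT] at hx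
  rcases hx.1.lt_or_eq with h | h
  · exact h
  · exfalso
    have h2 := hx.2
    rw [rho, ← h] at h2
    have : 0 < ‖x‖ := norm_pos_iff.2 h0
    nlinarith

lemma norm_le_of_mem_cone {d : ℕ} {T : ℝ} (hT : 0 < T) {x : Euc d} (hx : x ∈ cone d T) :
    ‖x‖ ≤ (T + 1) * x 0 := by
  rw [mem_cone_iff hT] at hx
  have h2 := hx.2
  rw [rho] at h2
  refine abs_le_of_sq_le_sq' ?_ (mul_nonneg (by positivity) hx.1) |>.2
  have := mul_nonneg hT.le (sq_nonneg (x 0))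
  nlinarith

lemma contDiff_rho {d : ℕ} {T : ℝ} : ContDiff ℝ 2 (rho T : Euc d → ℝ) := by
  unfold rho
  have : ContDiff ℝ 2 fun x : Euc d => ‖x‖ ^ 2 := contDiff_norm_sq ℝ
  fun_prop

lemma hasFDerivAt_coord {d : ℕ} (j : Fin (d + 1)) (x : Euc d) :
    HasFDerivAt (fun y : Euc d => y j) (EuclideanSpace.proj j : Euc d →L[ℝ] ℝ) x :=
  (EuclideanSpace.proj j : Euc d →L[ℝ] ℝ).hasFDerivAt

lemma fderiv_rho {d : ℕ} {T : ℝ} (x v : Euc d) : fderiv ℝ (rho T) x v = inner ℝ (gradRho T x) v := by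
  have h1 := ((hasFDerivAt_coord 0 x).pow 2).const_mul (T ^ 2 + 1)
  have h2 := ((contDiffAt_norm_sq x).differentiableAt (by simp)).hasFDerivAt
  have h3 := (h1.sub h2).fderiv
  have e : (rho T : Euc d → ℝ) =
    (fun x : Euc d => (T ^ 2 + 1) * (x 0) ^ 2) - fun x : Euc d => ‖x‖ ^ 2 := rfl
  rw [e, h3]
  simp only [sub_apply, hasFDerivAt_norm_sq', gradRho, inner_sub_left,
    inner_smul_left]
  rw [real_inner_comm v (stdVec 0), inner_stdVec]
  simp
  ring

lemma gradRho_zero_coord {d : ℕ} {T : ℝ} (x : Euc d) : gradRho T x 0 = 2 * T ^ 2 * x 0 := by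
  simp [gradRho, stdVec]; ring

lemma inner_self_gradRho {d : ℕ} {T : ℝ} (x : Euc d) : inner ℝ x (gradRho T x) = 2 * rho T x := by
  rw [gradRho, inner_sub_right, inner_smul_right, inner_smul_right, inner_stdVec,
    real_inner_self_eq_norm_sq, rho]
  ring

lemma apply_eq_sum {d : ℕ} (l : Euc d →L[ℝ] ℝ) (v : Euc d) : l v = ∑ i, v i * l (stdVec i) := by
  have h : v = ∑ i, v i • stdVec i := by
    ext j
    simp [stdVec, Finset.sum_apply, Pi.single_apply]
  conv_lhs => rw [h]
  simp

lemma axis_mem_cone {d : ℕ} {T : ℝ} (hT : 0 < T) {a : ℝ} (ha : 0 ≤ a) :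
    a • stdVec 0 ∈ cone d T := by
  have := primeNorm_add_smul (d := d) 0 a
  simp only [cone, mem_ofPred_eq]
  simp only [zero_add] at this
  rw [this]
  have h0 : primeNorm (0 : Euc d) = 0 := by simp [primeNorm]
  rw [h0]
  simp [stdVec]
  positivity

/-- At a maximum over the cone located at a boundary point, the derivative along the inward
direction `gradRho` is nonpositive. -/
lemma fderivWithin_gradRho_nonpos {d : ℕ} {T : ℝ} (hT : 0 < T) {g : Euc d → ℝ} {x : Euc d}
    (hx : x ∈ cone d T) (hg : DifferentiableWithinAt ℝ g (cone d T) x)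
    (hmax : IsMaxOn g (cone d T) x) : fderivWithin ℝ g (cone d T) x (gradRho T x) ≤ 0 := by
  have h0 := ((mem_cone_iff hT).1 hx).1
  have hseg : segment ℝ x (x + (1 / 2 : ℝ) • gradRho T x) ⊆ cone d T := by
    refine convex_cone.segment_subset hx ?_
    have : x + (1 / 2 : ℝ) • gradRho T x = ((T ^ 2 + 1) * x 0) • stdVec 0 := by
      rw [gradRho]; module
    rw [this]
    exact axis_mem_cone hT (by positivity)
  have h1 := hmax.localize.hasFDerivWithinAt_nonpos hg.hasFDerivWithinAt
    (mem_posTangentConeAt_of_segment_subset hseg)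
  rw [map_smul, smul_eq_mul] at h1
  linarith

/-- The retraction of a point of the cone onto the boundary, parallel to the axis. -/
lemma exists_boundary_point {d : ℕ} {T : ℝ} (hT : 0 < T) {x : Euc d} (hx : x ∈ cone d T) :
    ∃ y ∈ cone d T, rho T y = 0 ∧ ‖y‖ ≤ ‖x‖ ∧ T ^ 2 * x 0 * ‖x - y‖ ≤ rho T x := by
  set a := x 0 - primeNorm x / T with ha
  have hp := primeNorm_nonneg x
  have hle : primeNorm x / T ≤ x 0 := by
    rw [div_le_iff₀ hT]; exact hx
  have hp' : 0 ≤ primeNorm x / T := by positivity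
  refine ⟨x + (-a) • stdVec 0, ?_, ?_, ?_, ?_⟩
  · simp only [cone, mem_ofPred_eq, primeNorm_add_smul]
    simp [stdVec, ha]
    rw [div_mul_cancel₀ _ hT.ne']
  · rw [rho_eq, primeNorm_add_smul]
    simp [stdVec, ha]
    field_simp
    ring
  · refine abs_le_of_sq_le_sq' ?_ (norm_nonneg _) |>.2
    have h1 := primeNorm_sq x
    have h2 := primeNorm_sq (x + (-a) • stdVec 0)
    rw [primeNorm_add_smul] at h2
    have h3 : (x + (-a) • stdVec 0 : Euc d) 0 = primeNorm x / T := by simp [stdVec, ha]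
    rw [h3] at h2
    nlinarith
  · have : ‖x - (x + (-a) • stdVec 0)‖ = a := by
      have e : x - (x + (-a) • stdVec 0) = a • stdVec 0 := by module
      rw [e, norm_smul, Real.norm_of_nonneg (by linarith)]
      simp [stdVec]
    rw [this, rho_eq, ha]
    have e : T ^ 2 * (x 0) ^ 2 - primeNorm x ^ 2 =
      T ^ 2 * ((x 0 - primeNorm x / T) * (x 0 + primeNorm x / T)) := by
      field_simp; ring
    rw [e]
    have := mul_nonneg (mul_nonneg (sq_nonneg T) (sub_nonneg.2 hle)) hp'
    nlinarith

/-- A smooth nondecreasing cutoff, equal to `0` on `(-∞, 1]` and to `1` on `[2, ∞)`. -/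
def cutoff (s : ℝ) : ℝ := Real.smoothTransition (s - 1)

lemma contDiff_cutoff : ContDiff ℝ 2 cutoff := by
  have : ContDiff ℝ 2 Real.smoothTransition := Real.smoothTransition.contDiff (n := 2)
  unfold cutoff
  fun_prop

lemma continuous_deriv_cutoff : Continuous (deriv cutoff) :=
  contDiff_cutoff.continuous_deriv (by norm_num)

lemma deriv_cutoff_nonneg (s : ℝ) : 0 ≤ deriv cutoff s := by
  have : Monotone cutoff := fun a b h => Real.smoothTransition.monotone (by linarith)
  exact this.deriv_nonneg

lemma cutoff_of_le {s : ℝ} (h : s ≤ 1) : cutoff s = 0 :=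
  Real.smoothTransition.zero_of_nonpos (by linarith)

lemma cutoff_of_ge {s : ℝ} (h : 2 ≤ s) : cutoff s = 1 :=
  Real.smoothTransition.one_of_one_le (by linarith)

lemma abs_cutoff_le (s : ℝ) : |cutoff s| ≤ 1 := by
  rw [cutoff, abs_of_nonneg (Real.smoothTransition.nonneg _)]
  exact Real.smoothTransition.le_one _

lemma deriv_cutoff_of_lt {s : ℝ} (h : s < 1) : deriv cutoff s = 0 := by
  have : cutoff =ᶠ[𝓝 s] fun _ => 0 := by
    filter_upwards [Iio_mem_nhds h] with y hy
    exact cutoff_of_le hy.le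
  rw [this.deriv_eq]; simp

lemma deriv_cutoff_of_gt {s : ℝ} (h : 2 < s) : deriv cutoff s = 0 := by
  have : cutoff =ᶠ[𝓝 s] fun _ => 1 := by
    filter_upwards [Ioi_mem_nhds h] with y hy
    exact cutoff_of_ge hy.le
  rw [this.deriv_eq]; simp

lemma exists_bound_mul_deriv_cutoff : ∃ M : ℝ, ∀ s, |s * deriv cutoff s| ≤ M := by
  have hc : Continuous fun s : ℝ => s * deriv cutoff s :=
    continuous_id.mul continuous_deriv_cutoff
  obtain ⟨M, hM⟩ := isCompact_Icc (a := (1 : ℝ)) (b := 2) |>.exists_bound_of_continuousOn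
    hc.continuousOn
  refine ⟨M, fun s => ?_⟩
  have h0 : 0 ≤ M := (norm_nonneg _).trans (hM 1 ⟨le_rfl, by norm_num⟩)
  by_cases h1 : s < 1
  · rw [deriv_cutoff_of_lt h1]; simpa using h0
  by_cases h2 : 2 < s
  · rw [deriv_cutoff_of_gt h2]; simpa using h0
  exact hM s ⟨not_lt.1 h1, not_lt.1 h2⟩

lemma ContDiffOn.fderivWithin_cone {d : ℕ} {T : ℝ} (hT : 0 < T) {q : Euc d → ℝ}
    (hq : ContDiffOn ℝ 2 q (cone d T)) :
    ContDiffOn ℝ 1 (fderivWithin ℝ q (cone d T)) (cone d T) :=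
  hq.fderivWithin (uniqueDiffOn_cone hT) (by norm_num)

lemma ContDiffOn.continuousOn_lapW {d : ℕ} {T : ℝ} (hT : 0 < T) {q : Euc d → ℝ}
    (hq : ContDiffOn ℝ 2 q (cone d T)) : ContinuousOn (lapW (cone d T) q) (cone d T) := by
  unfold lapW
  refine continuousOn_finsetSum _ fun i _ => ?_
  have h1 : ContDiffOn ℝ 1 (fun y => fderivWithin ℝ q (cone d T) y (stdVec i)) (cone d T) :=
    (hq.fderivWithin_cone hT).clm_apply contDiffOn_const
  exact (h1.continuousOn_fderivWithin (uniqueDiffOn_cone hT) (by norm_num)).clm_apply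
    continuousOn_const

lemma isCompact_cone_inter {d : ℕ} {T R : ℝ} : IsCompact (cone d T ∩ Metric.closedBall 0 R) :=
  (isCompact_closedBall 0 R).inter_left isClosed_cone

lemma convex_cone_inter {d : ℕ} {T R : ℝ} : Convex ℝ (cone d T ∩ Metric.closedBall 0 R) :=
  convex_cone.inter (convex_closedBall 0 R)

lemma exists_lower_bound_fderivWithin_gradRho {d : ℕ} {T R₁ R₂ : ℝ} (hT : 0 < T) (hR₁ : 0 < R₁)
    {q : Euc d → ℝ} (hq : ContDiffOn ℝ 2 q (cone d T))
    (hlat : ∀ x ∈ cone d T, rho T x = 0 → 0 ≤ fderivWithin ℝ q (cone d T) x (gradRho T x)) :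
    ∃ a : ℝ, 0 ≤ a ∧ ∀ x ∈ cone d T, R₁ ≤ ‖x‖ → ‖x‖ ≤ R₂ →
      -(a * rho T x) ≤ fderivWithin ℝ q (cone d T) x (gradRho T x) := by
  have hgr : ContDiff ℝ 1 (gradRho T : Euc d → Euc d) := by unfold gradRho; fun_prop
  have h1 : ContDiffOn ℝ 1 (fun x => fderivWithin ℝ q (cone d T) x (gradRho T x)) (cone d T) :=
    (hq.fderivWithin_cone hT).clm_apply hgr.contDiffOn
  obtain ⟨K, hK⟩ := (h1.mono (inter_subset_left (t := Metric.closedBall 0 R₂))).exists_lipschitzOnWith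
    (by simp) convex_cone_inter isCompact_cone_inter
  refine ⟨K * ((T + 1) / (T ^ 2 * R₁)), by positivity, fun x hx h2 h3 => ?_⟩
  obtain ⟨y, hy, hy0, hyn, hxy⟩ := exists_boundary_point hT hx
  have h4 := hK.dist_le_mul x ⟨hx, by simpa using h3⟩ y ⟨hy, by simpa using hyn.trans h3⟩
  rw [Real.dist_eq, dist_eq_norm] at h4
  have h5 := hlat y hy hy0
  have h6 := (abs_le.1 h4).1
  have h7 : R₁ ≤ (T + 1) * x 0 := h2.trans (norm_le_of_mem_cone hT hx)
  have h8 : ‖x - y‖ ≤ (T + 1) / (T ^ 2 * R₁) * rho T x := by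
    rw [div_mul_eq_mul_div, le_div_iff₀ (by positivity)]
    calc ‖x - y‖ * (T ^ 2 * R₁) = T ^ 2 * ‖x - y‖ * R₁ := by ring
      _ ≤ T ^ 2 * ‖x - y‖ * ((T + 1) * x 0) := by gcongr
      _ = (T + 1) * (T ^ 2 * x 0 * ‖x - y‖) := by ring
      _ ≤ _ := by gcongr
  have h9 : (K : ℝ) * ‖x - y‖ ≤ K * ((T + 1) / (T ^ 2 * R₁) * rho T x) := by gcongr
  linarith

lemma integral_fderiv_eq_zero {d : ℕ} {X : Euc d → ℝ} (hX : ContDiff ℝ 1 X)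
    (hc : HasCompactSupport X) (v : Euc d) :
    Integrable (fun x => fderiv ℝ X x v) ∧ ∫ x, fderiv ℝ X x v = 0 := by
  have hint : Integrable (fun x => fderiv ℝ X x v) := by
    refine Continuous.integrable_of_hasCompactSupport ?_ (hc.fderiv_apply (𝕜 := ℝ) v)
    exact (hX.continuous_fderiv (by norm_num)).clm_apply continuous_const
  refine ⟨hint, ?_⟩
  have h := integral_mul_fderiv_eq_neg_fderiv_mul_of_integrable (μ := volume) (𝕜 := ℝ)
    (f := fun _ : Euc d => (1 : ℝ)) (g := X) (v := v) (by simp) (by simpa using hint)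
    (by simpa using hX.continuous.integrable_of_hasCompactSupport hc)
    (fun x _ => differentiableAt_const _) (fun x _ => hX.differentiable (by norm_num) x)
  simpa using h

/-- The truncated vector field used to integrate by parts in the cone. -/
def cutField {d : ℕ} (T a : ℝ) (q : Euc d → ℝ) (i : Fin (d + 1)) : Euc d → ℝ :=
  (coneInt d T).indicator fun x =>
    cutoff (a * rho T x) * (max (q x) 0) ^ 2 * fderiv ℝ q x (stdVec i)

section cutField

variable {d : ℕ} {T a R₂ : ℝ} {q : Euc d → ℝ}

lemma ContDiffOn.contDiffAt_coneInt (hq : ContDiffOn ℝ 2 q (cone d T)) {x : Euc d}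
    (hx : x ∈ coneInt d T) : ContDiffAt ℝ 2 q x := hq.contDiffAt (cone_mem_nhds hx)

lemma cutField_eventuallyEq {x : Euc d} (hx : x ∈ coneInt d T) (i : Fin (d + 1)) :
    cutField T a q i =ᶠ[𝓝 x] fun x =>
      cutoff (a * rho T x) * (max (q x) 0) ^ 2 * fderiv ℝ q x (stdVec i) := by
  filter_upwards [isOpen_coneInt.mem_nhds hx] with y hy
  simp [cutField, hy]

lemma cutField_eventually_zero (hT : 0 < T) (ha : 0 < a) {x : Euc d} (hx : x ∉ coneInt d T)
    (i : Fin (d + 1)) : cutField T a q i =ᶠ[𝓝 x] fun _ => 0 := by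
  have hcl : IsClosed {y : Euc d | 0 ≤ y 0 ∧ 1 / a ≤ rho T y} :=
    (isClosed_le continuous_const (by fun_prop : Continuous fun y : Euc d => y 0)).and
      (isClosed_le continuous_const contDiff_rho.continuous)
  have hxn : x ∈ {y : Euc d | 0 ≤ y 0 ∧ 1 / a ≤ rho T y}ᶜ := by
    intro h
    simp only [mem_ofPred_eq] at h
    exact hx ((mem_coneInt_iff hT).2 ⟨h.1, lt_of_lt_of_le (by positivity) h.2⟩)
  filter_upwards [hcl.isOpen_compl.mem_nhds hxn] with y hy
  by_cases hyO : y ∈ coneInt d T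
  · have h1 := (mem_coneInt_iff hT).1 hyO
    have h2 : rho T y < 1 / a := by
      by_contra hcon
      exact hy ⟨h1.1, not_lt.1 hcon⟩
    have h3 : a * rho T y ≤ 1 := by
      rw [lt_div_iff₀ ha] at h2; linarith
    simp [cutField, cutoff_of_le h3]
  · simp [cutField, hyO]

lemma contDiff_cutField (hT : 0 < T) (ha : 0 < a) (hq : ContDiffOn ℝ 2 q (cone d T))
    (i : Fin (d + 1)) : ContDiff ℝ 1 (cutField T a q i) := by
  rw [contDiff_iff_contDiffAt]
  intro x
  by_cases hx : x ∈ coneInt d T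
  · refine ContDiffAt.congr_of_eventuallyEq ?_ (cutField_eventuallyEq hx i)
    have h2 := hq.contDiffAt_coneInt hx
    have h3 : ContDiffAt ℝ 1 (fun x => fderiv ℝ q x (stdVec i)) x :=
      (h2.fderiv_right (m := 1) (by norm_num)).clm_apply contDiffAt_const
    have h4 : ContDiffAt ℝ 1 (fun x => (max (q x) 0) ^ 2) x :=
      contDiff_sqPos.contDiffAt.comp x (h2.of_le (by norm_num))
    have h5 : ContDiffAt ℝ 1 (fun x : Euc d => cutoff (a * rho T x)) x :=
      ((contDiff_cutoff.comp (contDiff_const.mul contDiff_rho)).of_le (by norm_num)).contDiffAt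
    exact (h5.mul h4).mul h3
  · exact contDiffAt_const.congr_of_eventuallyEq (cutField_eventually_zero hT ha hx i)

lemma hasCompactSupport_cutField (hz : ∀ x ∈ cone d T, R₂ ≤ ‖x‖ → q x ≤ 0) (i : Fin (d + 1)) :
    HasCompactSupport (cutField T a q i) := by
  refine HasCompactSupport.intro (isCompact_closedBall (0 : Euc d) R₂) fun x hx => ?_
  have hx' : R₂ ≤ ‖x‖ := by
    simp only [Metric.mem_closedBall, dist_zero_right, not_le] at hx; exact hx.le
  by_cases hxO : x ∈ coneInt d T
  · simp [cutField, hxO, hz x (coneInt_subset_cone hxO) hx']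
  · simp [cutField, hxO]

lemma sum_fderiv_cutField (hq : ContDiffOn ℝ 2 q (cone d T)) {x : Euc d}
    (hx : x ∈ coneInt d T) :
    ∑ i, fderiv ℝ (cutField T a q i) x (stdVec i) =
      a * deriv cutoff (a * rho T x) * (max (q x) 0) ^ 2 *
          fderivWithin ℝ q (cone d T) x (gradRho T x)
        + 2 * cutoff (a * rho T x) * max (q x) 0 * ∑ i, (fderiv ℝ q x (stdVec i)) ^ 2
        + cutoff (a * rho T x) * (max (q x) 0) ^ 2 * lapW (cone d T) q x := by
  rw [lapW_eq_lap (cone_mem_nhds hx), fderivWithin_of_mem_nhds (cone_mem_nhds hx),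
    apply_eq_sum, lap, Finset.mul_sum, Finset.mul_sum, Finset.mul_sum,
    ← Finset.sum_add_distrib, ← Finset.sum_add_distrib]
  refine Finset.sum_congr rfl fun i _ => ?_
  rw [(cutField_eventuallyEq hx i).fderiv_eq]
  have h2 := hq.contDiffAt_coneInt hx
  have h3 := (h2.differentiableAt_partial (stdVec i)).hasFDerivAt
  have h4 : HasFDerivAt (fun x => (max (q x) 0) ^ 2) ((2 * max (q x) 0) • fderiv ℝ q x) x := by
    have := (hasDerivAt_max_pow (n := 0) (q x)).comp_hasFDerivAt x
      (h2.differentiableAt (by simp)).hasFDerivAt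
    norm_num at this
    exact this
  have hρ : HasFDerivAt (fun x : Euc d => a * rho T x) (a • fderiv ℝ (rho T) x) x :=
    ((contDiff_rho.differentiable (by norm_num)) x).hasFDerivAt.const_mul a
  have h5 : HasFDerivAt (fun x : Euc d => cutoff (a * rho T x))
      (deriv cutoff (a * rho T x) • a • fderiv ℝ (rho T) x) x :=
    ((contDiff_cutoff.differentiable (by norm_num)) _).hasDerivAt.comp_hasFDerivAt x hρ
  rw [((h5.fun_mul h4).fun_mul h3).fderiv]
  simp only [_root_.add_apply, _root_.smul_apply, smul_eq_mul, fderiv_rho, inner_stdVec]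
  ring

end cutField

/-- Integration by parts in the cone against the squared positive part. -/
theorem integral_sqPos_mul_lapW_nonpos {d : ℕ} {T R₁ R₂ : ℝ} (hT : 0 < T) (hR₁ : 0 < R₁)
    {q : Euc d → ℝ} (hq : ContDiffOn ℝ 2 q (cone d T))
    (hz₁ : ∀ x ∈ cone d T, ‖x‖ ≤ R₁ → q x ≤ 0) (hz₂ : ∀ x ∈ cone d T, R₂ ≤ ‖x‖ → q x ≤ 0)
    (hlat : ∀ x ∈ cone d T, rho T x = 0 → 0 ≤ fderivWithin ℝ q (cone d T) x (gradRho T x)) :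
    ∫ x in coneInt d T ∩ Metric.ball 0 R₂, (max (q x) 0) ^ 2 * lapW (cone d T) q x ≤ 0 := by
  obtain ⟨c, hc, hcb⟩ := exists_lower_bound_fderivWithin_gradRho (R₂ := R₂) hT hR₁ hq hlat
  obtain ⟨M, hM⟩ := exists_bound_mul_deriv_cutoff
  have hsub : cone d T ∩ Metric.closedBall 0 R₂ ⊆ cone d T := inter_subset_left
  obtain ⟨B, hB⟩ := (isCompact_cone_inter (R := R₂)).exists_bound_of_continuousOn
    (hq.continuousOn.mono hsub)
  obtain ⟨Λ, hΛ⟩ := (isCompact_cone_inter (R := R₂)).exists_bound_of_continuousOn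
    ((hq.continuousOn_lapW hT).mono hsub)
  set D := coneInt d T ∩ Metric.ball (0 : Euc d) R₂ with hD
  have hDo : IsOpen D := isOpen_coneInt.inter Metric.isOpen_ball
  have hDC : D ⊆ cone d T ∩ Metric.closedBall 0 R₂ :=
    inter_subset_inter coneInt_subset_cone Metric.ball_subset_closedBall
  have hDfin : volume D ≠ ⊤ :=
    ((measure_mono inter_subset_right).trans_lt (measure_ball_lt_top (x := (0 : Euc d)) (r := R₂))).ne
  let F : ℕ → Euc d → ℝ := fun n x =>
    cutoff ((n + 1 : ℝ) * rho T x) * (max (q x) 0) ^ 2 * lapW (cone d T) q x -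
      c * (max (q x) 0) ^ 2 *
        (((n + 1 : ℝ) * rho T x) * deriv cutoff ((n + 1 : ℝ) * rho T x))
  have hmax : ∀ x ∈ D, (max (q x) 0) ^ 2 ≤ B ^ 2 := by
    intro x hx
    have h1 := hB x (hDC hx)
    have h2 : 0 ≤ B := (norm_nonneg _).trans h1
    have : max (q x) 0 ≤ B := max_le ((le_abs_self _).trans h1) h2
    gcongr
  have hFm : ∀ n, ContinuousOn (F n) D := by
    intro n
    have h1 : ContinuousOn q D := hq.continuousOn.mono (hDC.trans hsub)
    have h2 : ContinuousOn (lapW (cone d T) q) D := (hq.continuousOn_lapW hT).mono (hDC.trans hsub)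
    have h3 : Continuous fun x : Euc d => (n + 1 : ℝ) * rho T x :=
      continuous_const.mul contDiff_rho.continuous
    have h4 : ContinuousOn (fun x : Euc d => cutoff ((n + 1 : ℝ) * rho T x)) D :=
      (contDiff_cutoff.continuous.comp h3).continuousOn
    have h5 : ContinuousOn (fun x : Euc d => deriv cutoff ((n + 1 : ℝ) * rho T x)) D :=
      (continuous_deriv_cutoff.comp h3).continuousOn
    have h6 : ContinuousOn (fun x => (max (q x) 0) ^ 2) D := contDiff_sqPos.continuous.comp_continuousOn h1
    exact ((h4.mul h6).mul h2).sub ((continuousOn_const.mul h6).mul (h3.continuousOn.mul h5))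
  have hFb : ∀ n, ∀ x ∈ D, ‖F n x‖ ≤ B ^ 2 * Λ + c * B ^ 2 * M := by
    intro n x hx
    have hΛ0 : 0 ≤ Λ := (norm_nonneg _).trans (hΛ x (hDC hx))
    refine (norm_sub_le _ _).trans ?_
    simp only [norm_mul, Real.norm_eq_abs]
    rw [abs_of_nonneg (sq_nonneg (max (q x) 0)), abs_of_nonneg hc]
    have h1 := hmax x hx
    have h2 := hM ((n + 1 : ℝ) * rho T x)
    have h3 := abs_cutoff_le ((n + 1 : ℝ) * rho T x)
    have h4 := hΛ x (hDC hx)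
    rw [Real.norm_eq_abs] at h4
    have h5 : |cutoff ((n + 1 : ℝ) * rho T x)| * (max (q x) 0) ^ 2 ≤ 1 * B ^ 2 := by gcongr
    rw [one_mul] at h5
    rw [← abs_mul (n + 1 : ℝ), ← abs_mul (_ * _)]
    gcongr
  have hFle : ∀ n, ∫ x in D, F n x ≤ 0 := by
    intro n
    have ha : (0 : ℝ) < n + 1 := by positivity
    have hI := fun i => integral_fderiv_eq_zero (contDiff_cutField hT ha hq i)
      (hasCompactSupport_cutField hz₂ i) (stdVec i)
    have hsum : ∫ x, ∑ i, fderiv ℝ (cutField T (n + 1 : ℝ) q i) x (stdVec i) = 0 := by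
      rw [integral_finsetSum _ fun i _ => (hI i).1]
      exact Finset.sum_eq_zero fun i _ => (hI i).2
    have hintg : Integrable fun x => ∑ i, fderiv ℝ (cutField T (n + 1 : ℝ) q i) x (stdVec i) :=
      integrable_finsetSum _ fun i _ => (hI i).1
    have hzero : ∀ x, x ∉ D → ∑ i, fderiv ℝ (cutField T (n + 1 : ℝ) q i) x (stdVec i) = 0 := by
      intro x hx
      by_cases hxO : x ∈ coneInt d T
      · have hR : R₂ ≤ ‖x‖ := by
          by_contra hcon
          exact hx ⟨hxO, by simpa using hcon⟩
        rw [sum_fderiv_cutField hq hxO, max_eq_right (hz₂ x (coneInt_subset_cone hxO) hR)]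
        simp
      · refine Finset.sum_eq_zero fun i _ => ?_
        rw [(cutField_eventually_zero hT ha hxO i).fderiv_eq]
        simp
    rw [← setIntegral_eq_integral_of_forall_compl_eq_zero (s := D) hzero] at hsum
    rw [← hsum]
    refine setIntegral_mono_on ?_ hintg.integrableOn hDo.measurableSet fun x hx => ?_
    · exact IntegrableOn.of_bound hDfin.lt_top ((hFm n).aestronglyMeasurable hDo.measurableSet) _
        ((ae_restrict_iff' hDo.measurableSet).2 (Eventually.of_forall (hFb n)))
    · rw [sum_fderiv_cutField hq hx.1]
      have hCx : x ∈ cone d T := (hDC hx).1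
      have hk0 : 0 ≤ cutoff ((n + 1 : ℝ) * rho T x) := Real.smoothTransition.nonneg _
      have hk1 := deriv_cutoff_nonneg ((n + 1 : ℝ) * rho T x)
      have hm0 : 0 ≤ max (q x) 0 := le_max_right _ _
      have hterm : 0 ≤ 2 * cutoff ((n + 1 : ℝ) * rho T x) * max (q x) 0 *
          ∑ i, (fderiv ℝ q x (stdVec i)) ^ 2 := by positivity
      have hkey : -(c * (max (q x) 0) ^ 2 *
          (((n + 1 : ℝ) * rho T x) * deriv cutoff ((n + 1 : ℝ) * rho T x))) ≤
          (n + 1 : ℝ) * deriv cutoff ((n + 1 : ℝ) * rho T x) * (max (q x) 0) ^ 2 *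
          fderivWithin ℝ q (cone d T) x (gradRho T x) := by
        by_cases hxR : ‖x‖ ≤ R₁
        · rw [max_eq_right (hz₁ x hCx hxR)]; simp
        · have h1 := hcb x hCx (not_le.1 hxR).le (by simpa using (hDC hx).2)
          have h2 : 0 ≤ (n + 1 : ℝ) * deriv cutoff ((n + 1 : ℝ) * rho T x) * (max (q x) 0) ^ 2 := by
            positivity
          have := mul_le_mul_of_nonneg_left h1 h2
          nlinarith
      simp only [F]
      linarith
  have hlim : Tendsto (fun n => ∫ x in D, F n x) atTop
      (𝓝 (∫ x in D, (max (q x) 0) ^ 2 * lapW (cone d T) q x)) := by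
    refine tendsto_integral_of_dominated_convergence (fun _ => B ^ 2 * Λ + c * B ^ 2 * M)
      (fun n => (hFm n).aestronglyMeasurable hDo.measurableSet) ?_ ?_ ?_
    · exact integrableOn_const hDfin
    · exact fun n => (ae_restrict_iff' hDo.measurableSet).2 (Eventually.of_forall (hFb n))
    · refine (ae_restrict_iff' hDo.measurableSet).2 (Eventually.of_forall fun x hx => ?_)
      have hρ := ((mem_coneInt_iff hT).1 hx.1).2
      have ht : Tendsto (fun n : ℕ => ((n : ℝ) + 1) * rho T x) atTop atTop :=
        (tendsto_atTop_add_const_right _ _ tendsto_natCast_atTop_atTop).atTop_mul_const hρ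
      refine tendsto_const_nhds.congr' ?_
      filter_upwards [ht.eventually_gt_atTop 2] with n hn
      simp only [F]
      rw [cutoff_of_ge hn.le, deriv_cutoff_of_gt hn]
      ring
  exact le_of_tendsto' hlim hFle

/-- A bounded nonnegative subsolution of the heat equation in the cone, with Neumann boundary
condition, supported in an annulus, differentiable in time and of class `C²` in space
(no joint regularity is required), vanishing at time `0`. -/
structure SubSol (d : ℕ) (T R₁ R₂ B : ℝ) (ω : ℝ → Euc d → ℝ) : Prop where
  Tpos : 0 < T
  R₁pos : 0 < R₁
  R₂nonneg : 0 ≤ R₂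
  nonneg : ∀ t, ∀ x ∈ cone d T, 0 ≤ ω t x
  bdd : ∀ t, ∀ x ∈ cone d T, ω t x ≤ B
  zero_small : ∀ t, ∀ x ∈ cone d T, ‖x‖ ≤ R₁ → ω t x = 0
  zero_large : ∀ t, ∀ x ∈ cone d T, R₂ ≤ ‖x‖ → ω t x = 0
  diff : ∀ x ∈ cone d T, Differentiable ℝ fun t => ω t x
  smooth : ∀ t, ContDiffOn ℝ 2 (ω t) (cone d T)
  sub : ∀ t, ∀ x ∈ coneInt d T, deriv (fun s => ω s x) t ≤ lapW (cone d T) (ω t) x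
  lat : ∀ t, ∀ x ∈ cone d T, rho T x = 0 → fderivWithin ℝ (ω t) (cone d T) x (gradRho T x) = 0
  init : ∀ x ∈ cone d T, ω 0 x = 0

/-- A nonnegative function in the cone with nonnegative outer normal derivative and Laplacian
at most `K`. -/
structure Barrier (d : ℕ) (T K : ℝ) (g : Euc d → ℝ) : Prop where
  Knonneg : 0 ≤ K
  smooth : ContDiffOn ℝ 2 g (cone d T)
  nonneg : ∀ x ∈ cone d T, 0 ≤ g x
  lat : ∀ x ∈ cone d T, rho T x = 0 → fderivWithin ℝ g (cone d T) x (gradRho T x) ≤ 0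
  lap_le : ∀ x ∈ coneInt d T, lapW (cone d T) g x ≤ K

/-- One-sided semicontinuity in time of the maxima of `ω - g`. -/
def RUSC (d : ℕ) (T : ℝ) (ω : ℝ → Euc d → ℝ) (r : ℝ) : Prop :=
  ∀ g K, Barrier d T K g → ∀ l > 0, (∃ δ > 0, ∀ q ∈ Ioo r (r + δ), ∃ x ∈ cone d T,
    l ≤ ω q x - g x) → ∃ x ∈ cone d T, l ≤ ω r x - g x

/-- A strict corrector for the Neumann condition in the cone. -/
def zeta {d : ℕ} (x : Euc d) : ℝ := ‖x‖ ^ 2 - x 0 + 1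

lemma contDiff_zeta {d : ℕ} : ContDiff ℝ 2 (zeta : Euc d → ℝ) := by
  have : ContDiff ℝ 2 fun x : Euc d => ‖x‖ ^ 2 := contDiff_norm_sq ℝ
  unfold zeta
  fun_prop

lemma zeta_nonneg {d : ℕ} (x : Euc d) : 0 ≤ zeta x := by
  have h : x 0 ≤ ‖x‖ := (le_abs_self _).trans (PiLp.norm_apply_le x 0)
  unfold zeta
  nlinarith [sq_nonneg (‖x‖ - 1 / 2)]

lemma lap_zeta {d : ℕ} (x : Euc d) : lap (zeta : Euc d → ℝ) x = 2 * (d + 1) := by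
  have h1 : ContDiffAt ℝ 2 (fun y : Euc d => ‖y‖ ^ 2) x := contDiffAt_norm_sq x
  have h2 : ContDiffAt ℝ 2 (fun y : Euc d => y 0) x := by fun_prop
  have e : (zeta : Euc d → ℝ) = fun y : Euc d => (‖y‖ ^ 2 - y 0) + 1 := rfl
  rw [e, lap_add (h1.sub h2) contDiffAt_const, lap_sub h1 h2, lap_norm_sq, lap_coord, lap_const]
  ring

lemma fderiv_zeta_gradRho {d : ℕ} {T : ℝ} {x : Euc d} (hx : rho T x = 0) :
    fderiv ℝ (zeta : Euc d → ℝ) x (gradRho T x) = -(2 * T ^ 2 * x 0) := by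
  have h1 := ((contDiffAt_norm_sq x).differentiableAt (by simp)).hasFDerivAt
  have h2 := ((h1.sub (hasFDerivAt_coord 0 x)).add_const 1).fderiv
  have e : (zeta : Euc d → ℝ) =
    fun y : Euc d => ((fun y : Euc d => ‖y‖ ^ 2) - fun y : Euc d => y 0) y + 1 := rfl
  rw [e, h2]
  simp only [_root_.sub_apply, hasFDerivAt_norm_sq', inner_self_gradRho, hx]
  have : (EuclideanSpace.proj 0 : Euc d →L[ℝ] ℝ) (gradRho T x) = gradRho T x 0 := rfl
  rw [this, gradRho_zero_coord]
  ring

lemma lapW_add_const_zeta {d : ℕ} {T : ℝ} {g : Euc d → ℝ} (hg : ContDiffOn ℝ 2 g (cone d T))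
    (η k : ℝ) {x : Euc d} (hx : x ∈ coneInt d T) :
    lapW (cone d T) (fun y => g y + η * zeta y + k) x =
      lapW (cone d T) g x + η * (2 * (d + 1)) := by
  have h1 := hg.contDiffAt_coneInt hx
  have h2 : ContDiffAt ℝ 2 (fun y : Euc d => η * zeta y) x :=
    (contDiff_const.mul contDiff_zeta).contDiffAt
  rw [lapW_eq_lap (cone_mem_nhds hx), lapW_eq_lap (cone_mem_nhds hx),
    lap_add (h1.add h2) contDiffAt_const, lap_add h1 h2, lap_const,
    lap_const_mul _ contDiff_zeta.contDiffAt, lap_zeta]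
  ring

lemma fderivWithin_add_const_zeta {d : ℕ} {T : ℝ} (hT : 0 < T) {g : Euc d → ℝ}
    (hg : ContDiffOn ℝ 2 g (cone d T)) (η k : ℝ) {x : Euc d} (hx : x ∈ cone d T)
    (hρ : rho T x = 0) :
    fderivWithin ℝ (fun y => g y + η * zeta y + k) (cone d T) x (gradRho T x) =
      fderivWithin ℝ g (cone d T) x (gradRho T x) - η * (2 * T ^ 2 * x 0) := by
  have h1 := (hg.differentiableOn (by norm_num) x hx).hasFDerivWithinAt
  have h2 := (((contDiff_zeta (d := d)).differentiable (by norm_num) x).hasFDerivAt.const_mul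
    η).hasFDerivWithinAt (s := cone d T)
  have h3 := ((h1.fun_add h2).add_const k).fderivWithin (uniqueDiffOn_cone hT x hx)
  rw [h3]
  simp only [_root_.add_apply, _root_.smul_apply, fderiv_zeta_gradRho hρ, smul_eq_mul]
  ring

lemma Barrier.add_const_zeta {d : ℕ} {T K : ℝ} (hT : 0 < T) {g : Euc d → ℝ}
    (hg : Barrier d T K g) {η k : ℝ} (hη : 0 ≤ η) (hk : 0 ≤ k) :
    Barrier d T (K + η * (2 * (d + 1))) (fun y => g y + η * zeta y + k) where
  Knonneg := by have := hg.Knonneg; positivity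
  smooth := (hg.smooth.add (contDiff_const.mul contDiff_zeta).contDiffOn).add contDiffOn_const
  nonneg x hx := by
    have h1 := hg.nonneg x hx
    have h2 := zeta_nonneg x
    positivity
  lat x hx hρ := by
    rw [fderivWithin_add_const_zeta hT hg.smooth η k hx hρ]
    have h1 := hg.lat x hx hρ
    have h2 := ((mem_cone_iff hT).1 hx).1
    have : 0 ≤ η * (2 * T ^ 2 * x 0) := by positivity
    linarith
  lap_le x hx := by
    rw [lapW_add_const_zeta hg.smooth η k hx]
    have := hg.lap_le x hx
    linarith

namespace SubSol

variable {d : ℕ} {T R₁ R₂ B : ℝ} {ω : ℝ → Euc d → ℝ}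

lemma exists_isMaxOn (hω : SubSol d T R₁ R₂ B ω) {g : Euc d → ℝ}
    (hg : ContinuousOn g (cone d T)) (hg0 : ∀ x ∈ cone d T, 0 ≤ g x) {r l : ℝ} (hl : 0 < l)
    (h : ∃ x ∈ cone d T, l ≤ ω r x - g x) :
    ∃ x ∈ cone d T, l ≤ ω r x - g x ∧ IsMaxOn (fun y => ω r y - g y) (cone d T) x := by
  obtain ⟨x₀, hx₀, hlx₀⟩ := h
  have hball : ∀ x ∈ cone d T, 0 < ω r x - g x → x ∈ cone d T ∩ Metric.closedBall 0 R₂ := by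
    intro x hx hpos
    refine ⟨hx, ?_⟩
    by_contra hcon
    simp only [Metric.mem_closedBall, dist_zero_right, not_le] at hcon
    have h1 := hω.zero_large r x hx hcon.le
    have h2 := hg0 x hx
    linarith
  obtain ⟨x, hx, hmax⟩ := (isCompact_cone_inter (d := d) (T := T) (R := R₂)).exists_isMaxOn
    ⟨x₀, hball x₀ hx₀ (hl.trans_le hlx₀)⟩
    (((hω.smooth r).continuousOn.sub hg).mono inter_subset_left)
  have hxl : l ≤ ω r x - g x := hlx₀.trans (hmax (hball x₀ hx₀ (hl.trans_le hlx₀)))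
  refine ⟨x, hx.1, hxl, fun y hy => ?_⟩
  by_cases hpos : 0 < ω r y - g y
  · exact hmax (hball y hy hpos)
  · exact (not_lt.1 hpos).trans (hl.le.trans hxl)

/-- Comparison with barriers growing linearly in time. -/
lemma le_barrier (hω : SubSol d T R₁ R₂ B ω) {s t : ℝ} (hst : s ≤ t)
    (hR : ∀ r ∈ Ico s t, RUSC d T ω r) {g : Euc d → ℝ} {K : ℝ} (hg : Barrier d T K g)
    (hs : ∀ x ∈ cone d T, ω s x ≤ g x) : ∀ x ∈ cone d T, ω t x ≤ g x + K * (t - s) := by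
  have hT := hω.Tpos
  have key : ∀ η > 0, ∀ x ∈ cone d T,
      ω t x ≤ g x + η * zeta x + (K + η * (2 * (d + 1)) + η) * (t - s) := by
    intro η hη
    by_contra hcon
    push Not at hcon
    obtain ⟨xs, hxs, hlt⟩ := hcon
    set K' := K + η * (2 * (d + 1)) + η with hK'
    have hK'0 : 0 ≤ K' := by have := hg.Knonneg; positivity
    set l := ω t xs - (g xs + η * zeta xs + K' * (t - s)) with hl
    have hlpos : 0 < l := by linarith
    let A : Set ℝ := {r | s ≤ r ∧ r ≤ t ∧ ∀ q ∈ Icc r t, ∃ x ∈ cone d T,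
      l ≤ ω q x - (g x + η * zeta x + K' * (q - s))}
    have htA : t ∈ A := by
      refine ⟨hst, le_rfl, fun q hq => ⟨xs, hxs, ?_⟩⟩
      rw [le_antisymm hq.2 hq.1]
    have hbdd : BddBelow A := ⟨s, fun r hr => hr.1⟩
    set r₀ := sInf A with hr₀
    have hsr : s ≤ r₀ := le_csInf ⟨t, htA⟩ fun r hr => hr.1
    have hrt : r₀ ≤ t := csInf_le hbdd htA
    have hright : ∀ q ∈ Ioc r₀ t, ∃ x ∈ cone d T,
        l ≤ ω q x - (g x + η * zeta x + K' * (q - s)) := by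
      intro q hq
      obtain ⟨r, hrA, hrq⟩ := exists_lt_of_csInf_lt ⟨t, htA⟩ hq.1
      exact hrA.2.2 q ⟨hrq.le, hq.2⟩
    have hk0 : 0 ≤ K' * (r₀ - s) := mul_nonneg hK'0 (by linarith)
    have hB := hg.add_const_zeta hT hη.le hk0
    have hex : ∃ x ∈ cone d T, l ≤ ω r₀ x - (g x + η * zeta x + K' * (r₀ - s)) := by
      rcases hrt.eq_or_lt with heq | hlt'
      · refine ⟨xs, hxs, ?_⟩
        rw [heq]
      · refine hR r₀ ⟨hsr, hlt'⟩ _ _ hB l hlpos ⟨t - r₀, by linarith, fun q hq => ?_⟩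
        obtain ⟨x, hx, hxl⟩ := hright q ⟨hq.1, by linarith [hq.2]⟩
        refine ⟨x, hx, ?_⟩
        have : K' * (r₀ - s) ≤ K' * (q - s) := by
          have := hq.1
          gcongr
        linarith
    obtain ⟨x, hx, hxl, hmax⟩ := hω.exists_isMaxOn hB.smooth.continuousOn hB.nonneg hlpos hex
    have hsr' : s < r₀ := by
      rcases hsr.eq_or_lt with heq | h
      · exfalso
        have h1 := hs x hx
        have h2 := mul_nonneg hη.le (zeta_nonneg x)
        rw [← heq] at hxl
        simp only [sub_self, mul_zero] at hxl
        linarith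
      · exact h
    have hx0 : x ≠ 0 := by
      rintro rfl
      have h1 := hω.zero_small r₀ 0 hx (by simpa using hω.R₁pos.le)
      have h2 := hB.nonneg 0 hx
      linarith
    have hxpos := pos_of_mem_cone hT hx hx0
    have hsm : ContDiffOn ℝ 2 (fun y => ω r₀ y - (g y + η * zeta y + K' * (r₀ - s))) (cone d T) :=
      (hω.smooth r₀).sub hB.smooth
    have hxO : x ∈ coneInt d T := by
      by_contra hxO
      have hρ := rho_eq_zero_of_mem_of_notMem hT hx hxO
      have h1 := fderivWithin_gradRho_nonpos hT hx
        (hsm.differentiableOn (by norm_num) x hx) hmax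
      rw [fderivWithin_fun_sub (uniqueDiffOn_cone hT x hx)
        ((hω.smooth r₀).differentiableOn (by norm_num) x hx)
        (hB.smooth.differentiableOn (by norm_num) x hx), _root_.sub_apply, hω.lat r₀ x hx hρ,
        fderivWithin_add_const_zeta hT hg.smooth η _ hx hρ] at h1
      have h2 := hg.lat x hx hρ
      have : 0 < η * (2 * T ^ 2 * x 0) := by positivity
      linarith
    have hlap : lapW (cone d T) (ω r₀) x ≤ lapW (cone d T) g x + η * (2 * (d + 1)) := by
      have h1 := lap_nonpos_of_isLocalMax (hsm.contDiffAt_coneInt hxO)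
        (hmax.isLocalMax (cone_mem_nhds hxO))
      rw [lap_sub ((hω.smooth r₀).contDiffAt_coneInt hxO) (hB.smooth.contDiffAt_coneInt hxO),
        ← lapW_eq_lap (cone_mem_nhds hxO), ← lapW_eq_lap (cone_mem_nhds hxO),
        lapW_add_const_zeta hg.smooth η _ hxO] at h1
      linarith
    have hder : HasDerivAt (fun q => ω q x - (g x + η * zeta x + K' * (q - s)))
        (deriv (fun q => ω q x) r₀ - K') r₀ := by
      have h1 := (hω.diff x hx r₀).hasDerivAt
      have h2 := ((((hasDerivAt_id r₀).sub_const s).const_mul K').const_add (g x + η * zeta x))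
      simp only [mul_one, id] at h2
      exact h1.sub h2
    have hneg : deriv (fun q => ω q x) r₀ - K' < 0 := by
      have h1 := hω.sub r₀ x hxO
      have h2 := hg.lap_le x hxO
      linarith
    have hleft : ∀ᶠ q in 𝓝[<] r₀, ω r₀ x - (g x + η * zeta x + K' * (r₀ - s)) ≤
        ω q x - (g x + η * zeta x + K' * (q - s)) := by
      have h1 := (hasDerivAt_iff_tendsto_slope_left_right.1 hder).1
      filter_upwards [h1.eventually (gt_mem_nhds hneg), self_mem_nhdsWithin] with q hq hq'
      have hq'' : q < r₀ := hq'
      rw [slope_def_field] at hq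
      rw [div_lt_iff_of_neg (by linarith)] at hq
      linarith
    obtain ⟨q₁, hq₁, hq₁'⟩ := mem_nhdsLT_iff_exists_Ioo_subset.1 hleft
    have hq₁r : q₁ < r₀ := hq₁
    set q₂ := max ((q₁ + r₀) / 2) s with hq₂
    have hq₂r : q₂ < r₀ := max_lt (by linarith) hsr'
    have hq₂A : q₂ ∈ A := by
      refine ⟨le_max_right _ _, hq₂r.le.trans hrt, fun q hq => ?_⟩
      rcases lt_trichotomy q r₀ with h | h | h
      · have : q₁ < q := lt_of_lt_of_le (by linarith) ((le_max_left _ _).trans hq.1)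
        exact ⟨x, hx, hxl.trans (hq₁' ⟨this, h⟩)⟩
      · rw [h]; exact ⟨x, hx, hxl⟩
      · exact hright q ⟨h, hq.2⟩
    exact absurd (csInf_le hbdd hq₂A) (not_le.2 hq₂r)
  intro x hx
  have hlim : Tendsto (fun η : ℝ => g x + η * zeta x + (K + η * (2 * (d + 1)) + η) * (t - s))
      (𝓝[>] 0) (𝓝 (g x + K * (t - s))) := by
    have hc : Continuous fun η : ℝ =>
      g x + η * zeta x + (K + η * (2 * (d + 1)) + η) * (t - s) := by fun_prop
    have := hc.tendsto 0
    simp only [zero_mul, add_zero] at this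
    exact this.mono_left nhdsWithin_le_nhds
  refine ge_of_tendsto hlim ?_
  filter_upwards [self_mem_nhdsWithin] with η hη
  exact key η hη x hx

end SubSol

lemma cubePos_nonneg (s : ℝ) : 0 ≤ cubePos s := pow_nonneg (le_max_right _ _) 3

lemma cubePos_of_nonpos {s : ℝ} (h : s ≤ 0) : cubePos s = 0 := by
  simp [cubePos, max_eq_right h]

lemma nonpos_of_cubePos_eq_zero {s : ℝ} (h : cubePos s = 0) : s ≤ 0 := by
  have := pow_eq_zero_iff (three_ne_zero) |>.1 h
  exact max_eq_right_iff.1 this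

lemma cubePos_sub_le {a b h B : ℝ} (hb : b ≤ B) (ha : a ≤ B) (hB : 0 ≤ B) (hh : 0 ≤ h)
    (hab : a ≤ b + h) : cubePos a - cubePos b ≤ 3 * B ^ 2 * h := by
  unfold cubePos
  have h1 : max a 0 ≤ max b 0 + h := max_le (hab.trans (by linarith [le_max_left b 0]))
    (by linarith [le_max_right b 0])
  have h2 : max a 0 ≤ B := max_le ha hB
  have h3 : max b 0 ≤ B := max_le hb hB
  have h4 := le_max_right a 0
  have h5 := le_max_right b 0
  have e : max a 0 ^ 3 - max b 0 ^ 3 =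
    (max a 0 - max b 0) * (max a 0 ^ 2 + max a 0 * max b 0 + max b 0 ^ 2) := by ring
  have hs : max a 0 ^ 2 + max a 0 * max b 0 + max b 0 ^ 2 ≤ 3 * B ^ 2 := by
    have i1 : max a 0 ^ 2 ≤ B ^ 2 := by gcongr
    have i2 : max b 0 ^ 2 ≤ B ^ 2 := by gcongr
    have i3 : max a 0 * max b 0 ≤ B * B := by gcongr
    nlinarith
  rw [e]
  calc (max a 0 - max b 0) * (max a 0 ^ 2 + max a 0 * max b 0 + max b 0 ^ 2)
      ≤ h * (max a 0 ^ 2 + max a 0 * max b 0 + max b 0 ^ 2) := by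
        gcongr; linarith
    _ ≤ h * (3 * B ^ 2) := by gcongr
    _ = _ := by ring

namespace SubSol

variable {d : ℕ} {T R₁ R₂ B : ℝ} {ω : ℝ → Euc d → ℝ}

lemma zero_mem_cone (hω : SubSol d T R₁ R₂ B ω) : (0 : Euc d) ∈ cone d T := by
  simpa using axis_mem_cone (d := d) hω.Tpos le_rfl

lemma B_nonneg (hω : SubSol d T R₁ R₂ B ω) : 0 ≤ B :=
  (hω.nonneg 0 0 hω.zero_mem_cone).trans (hω.bdd 0 0 hω.zero_mem_cone)

/-- Each time slice of a subsolution is a barrier. -/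
lemma exists_barrier (hω : SubSol d T R₁ R₂ B ω) (t : ℝ) : ∃ K, Barrier d T K (ω t) := by
  obtain ⟨K, hK⟩ := (isCompact_cone_inter (d := d) (T := T) (R := R₂)).exists_bound_of_continuousOn
    (((hω.smooth t).continuousOn_lapW hω.Tpos).mono inter_subset_left)
  have hK0 : 0 ≤ K := (norm_nonneg _).trans (hK 0 ⟨hω.zero_mem_cone, by simpa using hω.R₂nonneg⟩)
  refine ⟨K, hK0, hω.smooth t, hω.nonneg t, fun x hx h => (hω.lat t x hx h).le, fun x hx => ?_⟩
  by_cases hxb : ‖x‖ ≤ R₂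
  · exact (le_abs_self _).trans (hK x ⟨coneInt_subset_cone hx, by simpa using hxb⟩)
  · have : ω t =ᶠ[𝓝 x] fun _ => 0 := by
      filter_upwards [cone_mem_nhds hx, (isOpen_lt continuous_const continuous_norm).mem_nhds
        (not_le.1 hxb)] with y hy hy'
      exact hω.zero_large t y hy (le_of_lt hy')
    rw [lapW_eq_lap (cone_mem_nhds hx), lap_congr this, lap_const]
    exact hK0

/-- The region on which the energy of the excess over a barrier is computed. -/
abbrev region (d : ℕ) (T R₂ : ℝ) : Set (Euc d) := coneInt d T ∩ Metric.ball 0 R₂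

lemma isOpen_region : IsOpen (region d T R₂) := isOpen_coneInt.inter Metric.isOpen_ball

lemma region_subset : region d T R₂ ⊆ cone d T := inter_subset_left.trans coneInt_subset_cone

lemma volume_region_ne_top : volume (region d T R₂) ≠ ⊤ :=
  ((measure_mono inter_subset_right).trans_lt (measure_ball_lt_top (x := (0 : Euc d)) (r := R₂))).ne

/-- The excess of the subsolution over a moving barrier. -/
def excess (ω : ℝ → Euc d → ℝ) (g : Euc d → ℝ) (K a t : ℝ) (x : Euc d) : ℝ :=
  ω t x - (g x + K * (t - a))

lemma excess_le {g : Euc d → ℝ} {K a t : ℝ} (hg : Barrier d T K g)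
    (hat : a ≤ t) {x : Euc d} (hx : x ∈ cone d T) : excess ω g K a t x ≤ ω t x := by
  have h1 := hg.nonneg x hx
  have h2 : 0 ≤ K * (t - a) := mul_nonneg hg.Knonneg (by linarith)
  unfold excess
  linarith

lemma contDiffOn_excess (hω : SubSol d T R₁ R₂ B ω) {g : Euc d → ℝ} {K a : ℝ}
    (hg : Barrier d T K g) (t : ℝ) : ContDiffOn ℝ 2 (excess ω g K a t) (cone d T) :=
  (hω.smooth t).sub (hg.smooth.add contDiffOn_const)

lemma continuousOn_cubePos_excess (hω : SubSol d T R₁ R₂ B ω) {g : Euc d → ℝ} {K a : ℝ}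
    (hg : Barrier d T K g) (t : ℝ) :
    ContinuousOn (fun x => cubePos (excess ω g K a t x)) (cone d T) :=
  contDiff_cubePos.continuous.comp_continuousOn (hω.contDiffOn_excess hg t).continuousOn

lemma norm_cubePos_excess_le (hω : SubSol d T R₁ R₂ B ω) {g : Euc d → ℝ} {K a t : ℝ}
    (hg : Barrier d T K g) (hat : a ≤ t) {x : Euc d} (hx : x ∈ cone d T) :
    ‖cubePos (excess ω g K a t x)‖ ≤ B ^ 3 := by
  rw [Real.norm_of_nonneg (cubePos_nonneg _)]
  unfold cubePos
  have : max (excess ω g K a t x) 0 ≤ B :=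
    max_le ((excess_le hg hat hx).trans (hω.bdd t x hx)) hω.B_nonneg
  have h0 := le_max_right (excess ω g K a t x) 0
  gcongr

/-- The energy of the excess. -/
def energy (R₂ T : ℝ) (ω : ℝ → Euc d → ℝ) (g : Euc d → ℝ) (K a t : ℝ) : ℝ :=
  ∫ x in region d T R₂, cubePos (excess ω g K a t x)

lemma integrableOn_cubePos_excess (hω : SubSol d T R₁ R₂ B ω) {g : Euc d → ℝ} {K a t : ℝ}
    (hg : Barrier d T K g) (hat : a ≤ t) :
    IntegrableOn (fun x => cubePos (excess ω g K a t x)) (region d T R₂) :=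
  IntegrableOn.of_bound volume_region_ne_top.lt_top
    (((hω.continuousOn_cubePos_excess hg t).mono region_subset).aestronglyMeasurable
      isOpen_region.measurableSet) (B ^ 3)
    ((ae_restrict_iff' isOpen_region.measurableSet).2
      (Eventually.of_forall fun _ hx => hω.norm_cubePos_excess_le hg hat (region_subset hx)))

lemma continuousOn_energy (hω : SubSol d T R₁ R₂ B ω) {g : Euc d → ℝ} {K a : ℝ}
    (hg : Barrier d T K g) : ContinuousOn (energy R₂ T ω g K a) (Ici a) := by
  unfold energy
  refine continuousOn_of_dominated (bound := fun _ => B ^ 3) ?_ ?_ ?_ ?_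
  · exact fun t _ => ((hω.continuousOn_cubePos_excess hg t).mono region_subset).aestronglyMeasurable
      isOpen_region.measurableSet
  · exact fun t ht => (ae_restrict_iff' isOpen_region.measurableSet).2
      (Eventually.of_forall fun _ hx => hω.norm_cubePos_excess_le hg ht (region_subset hx))
  · exact integrableOn_const volume_region_ne_top
  · refine (ae_restrict_iff' isOpen_region.measurableSet).2 (Eventually.of_forall fun x hx => ?_)
    refine (contDiff_cubePos.continuous.comp ?_).continuousOn
    have := (hω.diff x (region_subset hx)).continuous
    unfold excess
    fun_prop

lemma eventually_slope_energy_lt (hω : SubSol d T R₁ R₂ B ω) {a b : ℝ}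
    (hR : ∀ r ∈ Ioo a b, RUSC d T ω r) {g : Euc d → ℝ} {K : ℝ} (hg : Barrier d T K g)
    {t : ℝ} (ht : t ∈ Ioo a b) {r : ℝ} (hr : 0 < r) :
    ∀ᶠ q in 𝓝[>] t, slope (energy R₂ T ω g K a) t q < r := by
  have hT := hω.Tpos
  obtain ⟨K₀, hK₀⟩ := hω.exists_barrier t
  set D := region d T R₂ with hD
  have hDm : MeasurableSet D := isOpen_region.measurableSet
  set z := excess ω g K a t with hz
  have hzs : ContDiffOn ℝ 2 z (cone d T) := hω.contDiffOn_excess hg t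
  let Z : Euc d → ℝ := fun x => 3 * ((max (z x) 0) ^ 2 * lapW (cone d T) z x)
  let P : ℝ → Euc d → ℝ := fun q x => cubePos (excess ω g K a q x)
  let S : ℝ → Euc d → ℝ := fun q x => (P q x - P t x) / (q - t)
  let E : ℝ → Euc d → ℝ := fun q x => max (S q x) (Z x)
  have hZle : ∫ x in D, Z x ≤ 0 := by
    have h1 : ∫ x in D, (max (z x) 0) ^ 2 * lapW (cone d T) z x ≤ 0 := by
      refine integral_sqPos_mul_lapW_nonpos hT hω.R₁pos hzs ?_ ?_ ?_
      · intro x hx hxR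
        have := excess_le (ω := ω) hg ht.1.le hx
        rwa [hω.zero_small t x hx hxR] at this
      · intro x hx hxR
        have := excess_le (ω := ω) hg ht.1.le hx
        rwa [hω.zero_large t x hx hxR] at this
      · intro x hx hρ
        have hgd := (hg.smooth.differentiableOn (by norm_num) x hx)
        have h1 := (((hω.smooth t).differentiableOn (by norm_num) x hx).hasFDerivWithinAt.fun_sub
          (hgd.hasFDerivWithinAt.add_const (K * (t - a)))).fderivWithin (uniqueDiffOn_cone hT x hx)
        have e : z = fun x => ω t x - (g x + K * (t - a)) := rfl
        rw [e, h1, _root_.sub_apply, hω.lat t x hx hρ]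
        have := hg.lat x hx hρ
        linarith
    have h2 : ∫ x in D, Z x = 3 * ∫ x in D, (max (z x) 0) ^ 2 * lapW (cone d T) z x :=
      integral_const_mul _ _
    rw [h2]; linarith
  have hZc : ContinuousOn Z (cone d T) := by
    have h1 : ContinuousOn (fun x => (max (z x) 0) ^ 2) (cone d T) :=
      contDiff_sqPos.continuous.comp_continuousOn hzs.continuousOn
    exact continuousOn_const.mul (h1.mul (hzs.continuousOn_lapW hT))
  obtain ⟨M, hM⟩ := (isCompact_cone_inter (d := d) (T := T) (R := R₂)).exists_bound_of_continuousOn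
    (hZc.mono inter_subset_left)
  have hMD : ∀ x ∈ D, |Z x| ≤ M := fun x hx =>
    hM x ⟨region_subset hx, Metric.ball_subset_closedBall hx.2⟩
  have hIoo : ∀ᶠ q in 𝓝[>] t, q ∈ Ioo t b := Ioo_mem_nhdsGT ht.2
  have hSc : ∀ q, ContinuousOn (S q) D := fun q =>
    (((hω.continuousOn_cubePos_excess hg q).sub
      (hω.continuousOn_cubePos_excess hg t)).div_const _).mono region_subset
  have hEc : ∀ q, ContinuousOn (E q) D := fun q => (hSc q).sup (hZc.mono region_subset)
  have hSle : ∀ q ∈ Ioo t b, ∀ x ∈ D, S q x ≤ 3 * B ^ 2 * K₀ := by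
    intro q hq x hx
    have hxC := region_subset hx
    have h1 := hω.le_barrier (s := t) (t := q) hq.1.le
      (fun r hr => hR r ⟨ht.1.trans_le hr.1, hr.2.trans hq.2⟩) hK₀ (fun _ _ => le_rfl) x hxC
    have hqt : 0 < q - t := by linarith [hq.1]
    have hat : a ≤ t := ht.1.le
    have h2 := cubePos_sub_le (a := excess ω g K a q x) (b := excess ω g K a t x)
      (h := K₀ * (q - t)) ((excess_le hg hat hxC).trans (hω.bdd t x hxC))
      ((excess_le hg (hat.trans hq.1.le) hxC).trans (hω.bdd q x hxC)) hω.B_nonneg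
      (mul_nonneg hK₀.Knonneg hqt.le) (by
        have : K * (t - a) ≤ K * (q - a) := by
          have := hg.Knonneg
          have := hq.1
          gcongr
        unfold excess
        linarith)
    simp only [S, P]
    rw [div_le_iff₀ hqt]
    linarith
  have hEb : ∀ q ∈ Ioo t b, ∀ x ∈ D, ‖E q x‖ ≤ max (3 * B ^ 2 * K₀) M := by
    intro q hq x hx
    rw [Real.norm_eq_abs, abs_le]
    have h1 := abs_le.1 (hMD x hx)
    constructor
    · have h2 : Z x ≤ E q x := le_max_right _ _
      have h3 : M ≤ max (3 * B ^ 2 * K₀) M := le_max_right _ _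
      linarith
    · exact max_le_max (hSle q hq x hx) h1.2
  have hlim : Tendsto (fun q => ∫ x in D, E q x) (𝓝[>] t) (𝓝 (∫ x in D, Z x)) := by
    refine tendsto_integral_filter_of_dominated_convergence
      (fun _ => max (3 * B ^ 2 * K₀) M) ?_ ?_ ?_ ?_
    · exact Eventually.of_forall fun q => (hEc q).aestronglyMeasurable hDm
    · filter_upwards [hIoo] with q hq
      exact (ae_restrict_iff' hDm).2 (Eventually.of_forall (hEb q hq))
    · exact integrableOn_const volume_region_ne_top
    · refine (ae_restrict_iff' hDm).2 (Eventually.of_forall fun x hx => ?_)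
      have hxC := region_subset hx
      have hd1 : HasDerivAt (fun q => excess ω g K a q x) (deriv (fun q => ω q x) t - K) t := by
        have h1 := (hω.diff x hxC t).hasDerivAt
        have h2 := ((((hasDerivAt_id t).sub_const a).const_mul K).const_add (g x))
        simp only [mul_one, id] at h2
        exact h1.sub h2
      have hd2 : HasDerivAt (fun q => P q x)
          (3 * (max (z x) 0) ^ 2 * (deriv (fun q => ω q x) t - K)) t :=
        HasDerivAt.comp t (h₂ := cubePos) (hasDerivAt_cubePos (excess ω g K a t x)) hd1
      have h3 : Tendsto (fun q => S q x) (𝓝[>] t)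
          (𝓝 (3 * (max (z x) 0) ^ 2 * (deriv (fun q => ω q x) t - K))) := by
        have := (hasDerivAt_iff_tendsto_slope_left_right.1 hd2).2
        refine this.congr fun q => ?_
        rw [slope_def_field]
      have h4 : 3 * (max (z x) 0) ^ 2 * (deriv (fun q => ω q x) t - K) ≤ Z x := by
        have h5 := hω.sub t x hx.1
        have h6 := hg.lap_le x hx.1
        have h7 : lapW (cone d T) z x = lapW (cone d T) (ω t) x - lapW (cone d T) g x := by
          have e : z = fun x => ω t x - (g x + K * (t - a)) := rfl
          rw [lapW_eq_lap (cone_mem_nhds hx.1), lapW_eq_lap (cone_mem_nhds hx.1),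
            lapW_eq_lap (cone_mem_nhds hx.1), e,
            lap_sub ((hω.smooth t).contDiffAt_coneInt hx.1)
              ((hg.smooth.contDiffAt_coneInt hx.1).add contDiffAt_const),
            lap_add (hg.smooth.contDiffAt_coneInt hx.1) contDiffAt_const, lap_const]
          ring
        simp only [Z]
        rw [h7, ← mul_assoc]
        have := sq_nonneg (max (z x) 0)
        gcongr
      have h5 := h3.max (tendsto_const_nhds (x := Z x))
      rwa [max_eq_right h4] at h5
  filter_upwards [hIoo, hlim.eventually (gt_mem_nhds (lt_of_le_of_lt hZle hr))] with q hq hq'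
  refine lt_of_le_of_lt ?_ hq'
  have hIq := hω.integrableOn_cubePos_excess hg (ht.1.le.trans hq.1.le)
  have hIt := hω.integrableOn_cubePos_excess hg ht.1.le
  have h1 : slope (energy R₂ T ω g K a) t q = ∫ x in D, S q x := by
    rw [slope_def_field]
    simp only [S, P]
    rw [integral_div, integral_sub hIq hIt]
    rfl
  rw [h1]
  refine setIntegral_mono_on ((hIq.sub hIt).div_const _) ?_ hDm fun x _ => le_max_left _ _
  exact IntegrableOn.of_bound volume_region_ne_top.lt_top ((hEc q).aestronglyMeasurable hDm) _
    ((ae_restrict_iff' hDm).2 (Eventually.of_forall (hEb q hq)))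

/-- Comparison from the left end of an interval inside which the maxima are semicontinuous. -/
lemma le_barrier_of_Ioo (hω : SubSol d T R₁ R₂ B ω) {a b : ℝ}
    (hR : ∀ r ∈ Ioo a b, RUSC d T ω r) {g : Euc d → ℝ} {K : ℝ} (hg : Barrier d T K g)
    (ha : ∀ x ∈ cone d T, ω a x ≤ g x) {t : ℝ} (ht : t ∈ Ioo a b) :
    ∀ x ∈ cone d T, ω t x ≤ g x + K * (t - a) := by
  have hT := hω.Tpos
  have hQa : energy R₂ T ω g K a a = 0 := by
    refine setIntegral_eq_zero_of_forall_eq_zero fun x hx => cubePos_of_nonpos ?_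
    have := ha x (region_subset hx)
    unfold excess
    simp only [sub_self, mul_zero]
    linarith
  have hmono : ∀ a' ∈ Ioo a t, energy R₂ T ω g K a t ≤ energy R₂ T ω g K a a' := by
    intro a' ha'
    refine image_le_of_liminf_slope_right_le_deriv_boundary (f := energy R₂ T ω g K a)
      (a := a') (b := t) (B := fun _ => energy R₂ T ω g K a a') (B' := fun _ => 0)
      ((hω.continuousOn_energy hg).mono fun s hs => ha'.1.le.trans hs.1) le_rfl
      continuousOn_const (fun s _ => hasDerivWithinAt_const _ _ _) ?_ ⟨ha'.2.le, le_rfl⟩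
    intro s hs r hr
    exact (hω.eventually_slope_energy_lt hR hg ⟨ha'.1.trans_le hs.1, hs.2.trans ht.2⟩ hr).frequently
  have hQt : energy R₂ T ω g K a t ≤ 0 := by
    have hc : Tendsto (energy R₂ T ω g K a) (𝓝[>] a) (𝓝 0) := by
      rw [← hQa]
      exact ((hω.continuousOn_energy hg) a self_mem_Ici).mono_left
        (nhdsWithin_mono a Ioi_subset_Ici_self)
    refine ge_of_tendsto hc ?_
    filter_upwards [Ioo_mem_nhdsGT ht.1] with a' ha'
    exact hmono a' ha'
  have hint := hω.integrableOn_cubePos_excess hg ht.1.le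
  have hzero : energy R₂ T ω g K a t = 0 :=
    le_antisymm hQt (integral_nonneg fun x => cubePos_nonneg _)
  have hae := (setIntegral_eq_zero_iff_of_nonneg_ae
    (Eventually.of_forall fun x => cubePos_nonneg _) hint).1 hzero
  have heq := Measure.eqOn_open_of_ae_eq hae isOpen_region
    ((hω.continuousOn_cubePos_excess hg t).mono region_subset) continuousOn_const
  have hO : ∀ x ∈ coneInt d T, ω t x ≤ g x + K * (t - a) := by
    intro x hx
    by_cases hxb : ‖x‖ < R₂
    · have := nonpos_of_cubePos_eq_zero (heq ⟨hx, by simpa using hxb⟩)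
      unfold excess at this
      linarith
    · have hxC := coneInt_subset_cone hx
      have := excess_le (ω := ω) hg ht.1.le hxC
      rw [hω.zero_large t x hxC (not_lt.1 hxb)] at this ⊢
      unfold excess at this
      rw [hω.zero_large t x hxC (not_lt.1 hxb)] at this
      linarith
  intro x hx
  refine ContinuousWithinAt.closure_le (cone_subset_closure hT hx) ?_ ?_ hO
  · exact ((hω.smooth t).continuousOn x hx).mono coneInt_subset_cone
  · exact ((hg.smooth.continuousOn x hx).mono coneInt_subset_cone).add continuousWithinAt_const

/-- Semicontinuity propagates to the left end of an interval. -/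
lemma rusc_of_Ioo (hω : SubSol d T R₁ R₂ B ω) {a b : ℝ} (hab : a < b)
    (hR : ∀ r ∈ Ioo a b, RUSC d T ω r) : RUSC d T ω a := by
  intro g K hg l hl ⟨δ, hδ, hq⟩
  by_contra hcon
  push Not at hcon
  have hT := hω.Tpos
  obtain ⟨k, hk0, hkl, hk⟩ : ∃ k, 0 ≤ k ∧ k < l ∧ ∀ x ∈ cone d T, ω a x - g x ≤ k := by
    obtain ⟨x, hx, hmax⟩ := (isCompact_cone_inter (d := d) (T := T) (R := R₂)).exists_isMaxOn
      ⟨0, hω.zero_mem_cone, by simpa using hω.R₂nonneg⟩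
      (((hω.smooth a).continuousOn.sub hg.smooth.continuousOn).mono inter_subset_left)
    refine ⟨max (ω a x - g x) 0, le_max_right _ _, max_lt (hcon x hx.1) hl, fun y hy => ?_⟩
    by_cases hyb : ‖y‖ ≤ R₂
    · exact (hmax ⟨hy, by simpa using hyb⟩).trans (le_max_left _ _)
    · have h1 := hω.zero_large a y hy (not_le.1 hyb).le
      have h2 := hg.nonneg y hy
      exact le_trans (by linarith) (le_max_right _ _)
  have hB := hg.add_const_zeta hT (le_refl (0 : ℝ)) hk0
  simp only [zero_mul, add_zero] at hB
  have hKn := hg.Knonneg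
  set ε := min (min δ (b - a)) ((l - k) / (K + 1)) with hε
  have hε0 : 0 < ε := by
    refine lt_min (lt_min hδ (by linarith)) (div_pos (by linarith) (by linarith))
  have hε1 : ε ≤ δ := (min_le_left _ _).trans (min_le_left _ _)
  have hε2 : ε ≤ b - a := (min_le_left _ _).trans (min_le_right _ _)
  have hε3 : ε * (K + 1) ≤ l - k := by
    have := min_le_right (min δ (b - a)) ((l - k) / (K + 1))
    rw [← hε, le_div_iff₀ (by linarith)] at this
    exact this
  obtain ⟨x, hx, hxl⟩ := hq (a + ε / 2) ⟨by linarith, by linarith⟩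
  have h1 := hω.le_barrier_of_Ioo hR hB (fun x hx => by linarith [hk x hx])
    (t := a + ε / 2) ⟨by linarith, by linarith⟩ x hx
  have h2 : K * (a + ε / 2 - a) < l - k := by nlinarith
  linarith

/-- The times at which `ω` is Lipschitz in space with constant `n`. -/
def lipTimes (d : ℕ) (T R₂ : ℝ) (ω : ℝ → Euc d → ℝ) (n : ℕ) : Set ℝ :=
  {t | ∀ x ∈ cone d T ∩ Metric.closedBall 0 R₂, ∀ y ∈ cone d T ∩ Metric.closedBall 0 R₂,
    |ω t x - ω t y| ≤ n * ‖x - y‖}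

lemma isClosed_lipTimes (hω : SubSol d T R₁ R₂ B ω) (n : ℕ) :
    IsClosed (lipTimes d T R₂ ω n) := by
  have e : lipTimes d T R₂ ω n = ⋂ x ∈ cone d T ∩ Metric.closedBall 0 R₂,
      ⋂ y ∈ cone d T ∩ Metric.closedBall 0 R₂, {t | |ω t x - ω t y| ≤ n * ‖x - y‖} := by
    ext t
    simp only [lipTimes, mem_ofPred_eq, mem_iInter]
  rw [e]
  refine isClosed_biInter fun x hx => isClosed_biInter fun y hy => ?_
  exact isClosed_le ((hω.diff x hx.1).continuous.sub (hω.diff y hy.1).continuous).abs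
    continuous_const

lemma exists_mem_lipTimes (hω : SubSol d T R₁ R₂ B ω) (t : ℝ) :
    ∃ n, t ∈ lipTimes d T R₂ ω n := by
  obtain ⟨K, hK⟩ := (((hω.smooth t).of_le (m := 1) (by norm_num)).mono
    inter_subset_left).exists_lipschitzOnWith (by norm_num) convex_cone_inter
      (isCompact_cone_inter (d := d) (T := T) (R := R₂))
  obtain ⟨n, hn⟩ := exists_nat_ge (K : ℝ)
  refine ⟨n, fun x hx y hy => ?_⟩
  have h1 := hK.dist_le_mul x hx y hy
  rw [Real.dist_eq, dist_eq_norm] at h1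
  exact h1.trans (by gcongr)

lemma rusc_of_lipTimes (hω : SubSol d T R₁ R₂ B ω) {r : ℝ} {n : ℕ}
    (h : ∀ δ > 0, ∃ q ∈ Ioo r (r + δ), q ∈ lipTimes d T R₂ ω n) : RUSC d T ω r := by
  rintro g K hg l hl ⟨δ, hδ, hq⟩
  have hex : ∀ k : ℕ, ∃ q x, q ∈ Ioo r (r + 1 / ((k : ℝ) + 1)) ∧ q ∈ lipTimes d T R₂ ω n ∧
      x ∈ cone d T ∩ Metric.closedBall 0 R₂ ∧ l ≤ ω q x - g x := by
    intro k
    have hp : 0 < min δ (1 / ((k : ℝ) + 1)) := lt_min hδ (by positivity)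
    obtain ⟨q, hq1, hq2⟩ := h _ hp
    obtain ⟨x, hx, hxl⟩ := hq q ⟨hq1.1, hq1.2.trans_le (by linarith [min_le_left δ (1 / ((k : ℝ) + 1))])⟩
    refine ⟨q, x, ⟨hq1.1, hq1.2.trans_le (by linarith [min_le_right δ (1 / ((k : ℝ) + 1))])⟩, hq2,
      ⟨hx, ?_⟩, hxl⟩
    by_contra hcon
    simp only [Metric.mem_closedBall, dist_zero_right, not_le] at hcon
    have h1 := hω.zero_large q x hx hcon.le
    have h2 := hg.nonneg x hx
    linarith
  choose q x hq1 hq2 hx hl' using hex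
  obtain ⟨y, hy, ψ, hψ, hlim⟩ := (isCompact_cone_inter (d := d) (T := T) (R := R₂)).tendsto_subseq hx
  have hqr : Tendsto q atTop (𝓝 r) := by
    refine tendsto_of_tendsto_of_tendsto_of_le_of_le tendsto_const_nhds ?_
      (fun k => (hq1 k).1.le) (fun k => (hq1 k).2.le)
    simpa using tendsto_const_nhds.add (tendsto_one_div_add_atTop_nhds_zero_nat (𝕜 := ℝ))
  have hqψ := hqr.comp hψ.tendsto_atTop
  refine ⟨y, hy.1, ?_⟩
  have h1 : Tendsto (fun k => ω (q (ψ k)) y) atTop (𝓝 (ω r y)) :=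
    ((hω.diff y hy.1).continuous.tendsto r).comp hqψ
  have h2 : Tendsto (fun k => g (x (ψ k))) atTop (𝓝 (g y)) :=
    (hg.smooth.continuousOn y hy.1).tendsto.comp
      (tendsto_nhdsWithin_iff.2 ⟨hlim, Eventually.of_forall fun k => (hx _).1⟩)
  have h3 : Tendsto (fun k => (n : ℝ) * ‖x (ψ k) - y‖) atTop (𝓝 (n * ‖y - y‖)) :=
    (((hlim.sub_const y).norm).const_mul _)
  have h4 := (h1.add h3).sub h2
  simp only [sub_self, norm_zero, mul_zero, add_zero] at h4
  refine ge_of_tendsto h4 (Eventually.of_forall fun k => ?_)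
  have h5 := hq2 (ψ k) (x (ψ k)) (hx _) y hy
  have h6 := hl' (ψ k)
  have h7 := le_abs_self (ω (q (ψ k)) (x (ψ k)) - ω (q (ψ k)) y)
  linarith

/-- Semicontinuity holds at every time, by a Baire category argument. -/
lemma rusc (hω : SubSol d T R₁ R₂ B ω) (r : ℝ) : RUSC d T ω r := by
  by_contra hr
  set F : Set ℝ := closure {r | ¬ RUSC d T ω r} with hF
  have hFc : IsClosed F := isClosed_closure
  have hrF : r ∈ F := subset_closure hr
  have : Nonempty F := ⟨⟨r, hrF⟩⟩
  have : CompleteSpace F := hFc.completeSpace_coe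
  obtain ⟨n, ⟨p, hpF⟩, hp⟩ := nonempty_interior_of_iUnion_of_closed
    (f := fun n => ((↑) : F → ℝ) ⁻¹' lipTimes d T R₂ ω n)
    (fun n => (hω.isClosed_lipTimes n).preimage continuous_subtype_val)
    (by
      refine eq_univ_of_forall fun t => ?_
      obtain ⟨n, hn⟩ := hω.exists_mem_lipTimes t
      exact mem_iUnion.2 ⟨n, hn⟩)
  rw [mem_interior_iff_mem_nhds, nhds_subtype_eq_comap, mem_comap] at hp
  obtain ⟨U, hU, hUn⟩ := hp
  obtain ⟨ε, hε, hεU⟩ := Metric.mem_nhds_iff.1 hU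
  obtain ⟨s, hs, hsd⟩ := Metric.mem_closure_iff.1 hpF ε hε
  refine hs ?_
  have hsU : s ∈ Metric.ball p ε := by rwa [Metric.mem_ball, dist_comm]
  obtain ⟨ε', hε', hsub⟩ := Metric.isOpen_ball.mem_nhds hsU |> Metric.mem_nhds_iff.1
  by_cases hcase : ∃ δ > 0, ∀ q ∈ Ioo s (s + δ), q ∉ F
  · obtain ⟨δ, hδ, hq⟩ := hcase
    refine hω.rusc_of_Ioo (b := s + δ) (by linarith) fun q hq' => ?_
    by_contra hcon
    exact hq q hq' (subset_closure hcon)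
  · push Not at hcase
    refine hω.rusc_of_lipTimes (n := n) fun δ hδ => ?_
    obtain ⟨q, hq, hqF⟩ := hcase (min δ ε') (lt_min hδ hε')
    have hq1 : q < s + δ := hq.2.trans_le (by linarith [min_le_left δ ε'])
    have hq2 : q < s + ε' := hq.2.trans_le (by linarith [min_le_right δ ε'])
    refine ⟨q, ⟨hq.1, hq1⟩, ?_⟩
    have hqU : q ∈ U := hεU (hsub (by
      rw [Metric.mem_ball, Real.dist_eq, abs_of_pos (by linarith [hq.1])]
      linarith))
    exact @hUn ⟨q, hqF⟩ hqU

/-- A subsolution vanishing at time `0` vanishes at all later times. -/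
theorem nonpos (hω : SubSol d T R₁ R₂ B ω) {t : ℝ} (ht : 0 ≤ t) {x : Euc d}
    (hx : x ∈ cone d T) : ω t x ≤ 0 := by
  have hg : Barrier d T 0 (fun _ : Euc d => (0 : ℝ)) :=
    ⟨le_rfl, contDiffOn_const, fun _ _ => le_rfl, fun x _ _ => by simp, fun x hx => by
      rw [lapW_eq_lap (cone_mem_nhds hx), lap_const]⟩
  simpa using hω.le_barrier ht (fun r _ => hω.rusc r) hg (fun x hx => (hω.init x hx).le) x hx

end SubSol

namespace Bistable

variable {f : ℝ → ℝ} {θ : ℝ}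

lemma deriv_of_neg (hf : Bistable f θ) {s : ℝ} (hs : s < 0) : deriv f s = deriv f 0 := by
  have : f =ᶠ[𝓝 s] fun s => deriv f 0 * s := by
    filter_upwards [Iio_mem_nhds hs] with y hy using hf.ext_neg y hy
  rw [this.deriv_eq, deriv_const_mul_field, deriv_id'', mul_one]

lemma deriv_of_one_lt (hf : Bistable f θ) {s : ℝ} (hs : 1 < s) : deriv f s = deriv f 1 := by
  have : f =ᶠ[𝓝 s] fun s => deriv f 1 * (s - 1) := by
    filter_upwards [Ioi_mem_nhds hs] with y hy using hf.ext_pos y hy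
  rw [this.deriv_eq, deriv_const_mul_field, deriv_sub_const, deriv_id'', mul_one]

lemma continuous_deriv (hf : Bistable f θ) : Continuous (deriv f) :=
  hf.smooth.continuous_deriv le_rfl

lemma differentiable (hf : Bistable f θ) : Differentiable ℝ f :=
  hf.smooth.differentiable (by norm_num)

lemma exists_lipschitz (hf : Bistable f θ) :
    ∃ Λ : ℝ, 0 ≤ Λ ∧ ∀ a b, |f a - f b| ≤ Λ * |a - b| := by
  obtain ⟨Λ, hΛ⟩ := (isCompact_Icc (a := (0 : ℝ)) (b := 1)).exists_bound_of_continuousOn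
    hf.continuous_deriv.continuousOn
  have hall : ∀ s, ‖deriv f s‖ ≤ Λ := by
    intro s
    rcases lt_or_ge s 0 with h | h
    · rw [hf.deriv_of_neg h]; exact hΛ 0 (by simp)
    rcases lt_or_ge 1 s with h' | h'
    · rw [hf.deriv_of_one_lt h']; exact hΛ 1 (by simp)
    exact hΛ s ⟨h, h'⟩
  refine ⟨Λ, (norm_nonneg _).trans (hall 0), fun a b => ?_⟩
  exact convex_univ.norm_image_sub_le_of_norm_deriv_le (fun x _ => hf.differentiable x)
    (fun x _ => hall x) (mem_univ b) (mem_univ a)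

/-- Near the stable states the nonlinearity is decreasing with a definite slope. -/
lemma exists_slope (hf : Bistable f θ) : ∃ m > 0, ∃ σ > 0, σ < 1 ∧ ∀ a e, 0 ≤ e →
    (a + e ≤ 2 * σ ∨ 1 - σ ≤ a) → m * e ≤ f a - f (a + e) := by
  set m := min (-deriv f 0) (-deriv f 1) / 2 with hm
  have h0 := hf.df0
  have h1 := hf.df1
  have hm0 : 0 < m := by
    have : 0 < min (-deriv f 0) (-deriv f 1) := lt_min (by linarith) (by linarith)
    positivity
  have hlt0 : deriv f 0 < -m := by
    have := min_le_left (-deriv f 0) (-deriv f 1); linarith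
  have hlt1 : deriv f 1 < -m := by
    have := min_le_right (-deriv f 0) (-deriv f 1); linarith
  obtain ⟨ε₀, hε₀, hb₀⟩ := Metric.mem_nhds_iff.1
    (hf.continuous_deriv.continuousAt.eventually_lt_const hlt0)
  obtain ⟨ε₁, hε₁, hb₁⟩ := Metric.mem_nhds_iff.1
    (hf.continuous_deriv.continuousAt.eventually_lt_const hlt1)
  set σ := min (min ε₀ ε₁) 1 / 4 with hσ
  have hσ0 : 0 < min (min ε₀ ε₁) 1 := lt_min (lt_min hε₀ hε₁) one_pos
  have e0 : min (min ε₀ ε₁) 1 ≤ ε₀ := (min_le_left _ _).trans (min_le_left _ _)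
  have e1 : min (min ε₀ ε₁) 1 ≤ ε₁ := (min_le_left _ _).trans (min_le_right _ _)
  have e2 : min (min ε₀ ε₁) 1 ≤ 1 := min_le_right _ _
  have hl : ∀ s ≤ 2 * σ, deriv f s ≤ -m := by
    intro s hs
    rcases lt_or_ge s 0 with h | h
    · rw [hf.deriv_of_neg h]; exact hlt0.le
    · have : s ∈ Metric.ball (0 : ℝ) ε₀ := by
        rw [Metric.mem_ball, Real.dist_eq, sub_zero, abs_of_nonneg h]; linarith
      exact le_of_lt (hb₀ this)
  have hr : ∀ s, 1 - σ ≤ s → deriv f s ≤ -m := by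
    intro s hs
    rcases lt_or_ge 1 s with h | h
    · rw [hf.deriv_of_one_lt h]; exact hlt1.le
    · have : s ∈ Metric.ball (1 : ℝ) ε₁ := by
        rw [Metric.mem_ball, Real.dist_eq, abs_sub_comm, abs_of_nonneg (by linarith)]; linarith
      exact le_of_lt (hb₁ this)
  refine ⟨m, hm0, σ, by positivity, by linarith, fun a e he hcase => ?_⟩
  have key : f (a + e) - f a ≤ -m * (a + e - a) := by
    rcases hcase with h | h
    · exact (convex_Iic (2 * σ)).image_sub_le_mul_sub_of_deriv_le
        hf.differentiable.continuous.continuousOn hf.differentiable.differentiableOn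
        (fun x hx => hl x (mem_Iic.1 (interior_subset hx))) a (by simp only [mem_Iic]; linarith) (a + e) h (by linarith)
    · exact (convex_Ici (1 - σ)).image_sub_le_mul_sub_of_deriv_le
        hf.differentiable.continuous.continuousOn hf.differentiable.differentiableOn
        (fun x hx => hr x (mem_Ici.1 (interior_subset hx))) a h (a + e) (by simp only [mem_Ici]; linarith) (by linarith)
  linarith

end Bistable

namespace PlanarFront

variable {f φ : ℝ → ℝ} {θ c : ℝ}

lemma contDiff_deriv (hφ : PlanarFront f θ c φ) : ContDiff ℝ 1 (deriv φ) := by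
  have h : ContDiff ℝ (1 + 1) φ := by simpa [one_add_one_eq_two] using hφ.smooth
  exact (contDiff_succ_iff_deriv.1 h).2.2

lemma hasDerivAt (hφ : PlanarFront f θ c φ) (z : ℝ) : HasDerivAt φ (deriv φ z) z :=
  (hφ.smooth.differentiable (by norm_num) z).hasDerivAt

lemma hasDerivAt_deriv (hφ : PlanarFront f θ c φ) (z : ℝ) :
    HasDerivAt (deriv φ) (-c * deriv φ z - f (φ z)) z := by
  have h := (hφ.contDiff_deriv.differentiable (by norm_num) z).hasDerivAt
  have := hφ.ode z
  rwa [show deriv (deriv φ) z = -c * deriv φ z - f (φ z) by linarith] at h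

lemma deriv_nonpos (hφ : PlanarFront f θ c φ) (z : ℝ) : deriv φ z ≤ 0 :=
  hφ.anti.antitone.deriv_nonpos

lemma neg_deriv_le (hf : Bistable f θ) (hφ : PlanarFront f θ c φ) {z : ℝ} (hz : 0 ≤ z) :
    -deriv φ z ≤ -deriv φ 0 * Real.exp (-c * z) := by
  have hG : ∀ y, HasDerivAt (fun y => -deriv φ y * Real.exp (c * y))
      (f (φ y) * Real.exp (c * y)) y := by
    intro y
    have h1 := (hφ.hasDerivAt_deriv y).fun_neg
    have h2 := ((hasDerivAt_id y).const_mul c).exp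
    have e : f (φ y) * Real.exp (c * y) = -(-c * deriv φ y - f (φ y)) * Real.exp (c * id y) +
        -deriv φ y * (Real.exp (c * id y) * (c * 1)) := by
      simp only [id]
      ring
    rw [e]
    exact h1.fun_mul h2
  have hanti : AntitoneOn (fun y => -deriv φ y * Real.exp (c * y)) (Ici 0) := by
    refine antitoneOn_of_deriv_nonpos (convex_Ici 0)
      (fun y _ => (hG y).continuousAt.continuousWithinAt)
      (fun y _ => (hG y).differentiableAt.differentiableWithinAt) fun y hy => ?_
    rw [interior_Ici] at hy
    rw [(hG y).deriv]
    have : f (φ y) < 0 := hf.neg _ ⟨(hφ.mem y).1, by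
      rw [← hφ.pin]; exact hφ.anti hy⟩
    exact mul_nonpos_of_nonpos_of_nonneg this.le (Real.exp_pos _).le
  have h := hanti (self_mem_Ici) hz hz
  simp only [mul_zero, Real.exp_zero, mul_one] at h
  have h3 : Real.exp (c * z) * Real.exp (-c * z) = 1 := by
    rw [← Real.exp_add]; simp
  calc -deriv φ z = (-deriv φ z * Real.exp (c * z)) * Real.exp (-c * z) := by
        rw [mul_assoc, h3, mul_one]
    _ ≤ _ := by gcongr

lemma deriv_neg (hf : Bistable f θ) (hφ : PlanarFront f θ c φ) (z : ℝ) : deriv φ z < 0 := by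
  refine lt_of_le_of_ne (hφ.deriv_nonpos z) fun h0 => ?_
  have hmax : IsLocalMax (deriv φ) z := Eventually.of_forall fun y => by
    rw [h0]; exact hφ.deriv_nonpos y
  have h1 := hmax.hasDerivAt_eq_zero (hφ.hasDerivAt_deriv z)
  rw [h0] at h1
  have hfz : f (φ z) = 0 := by linarith
  have hz : z = 0 := by
    refine hφ.anti.injective ?_
    rw [hφ.pin]
    rcases lt_trichotomy (φ z) θ with h | h | h
    · exact absurd hfz (hf.neg _ ⟨(hφ.mem z).1, h⟩).ne
    · exact h
    · exact absurd hfz (hf.pos _ ⟨h, (hφ.mem z).2⟩).ne'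
  subst hz
  have hzero : ∀ y ∈ Ico (0 : ℝ) 1, derivWithin φ (Icc 0 1) y = 0 := by
    intro y hy
    rw [(hφ.hasDerivAt y).hasDerivWithinAt.derivWithin (uniqueDiffOn_Icc one_pos y ⟨hy.1, hy.2.le⟩)]
    have := hφ.neg_deriv_le hf hy.1
    rw [h0] at this
    simp only [neg_zero, zero_mul] at this
    exact le_antisymm (hφ.deriv_nonpos y) (by linarith)
  have := constant_of_derivWithin_zero
    (hφ.smooth.differentiable (by norm_num)).differentiableOn hzero 1 (by simp)
  exact absurd this (hφ.anti one_pos).ne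

lemma exists_pos_le_neg_deriv (hf : Bistable f θ) (hφ : PlanarFront f θ c φ) (M : ℝ)
    (hM : 0 ≤ M) : ∃ k > 0, ∀ z ∈ Icc (-M) M, k ≤ -deriv φ z := by
  obtain ⟨z₀, hz₀, hmin⟩ := (isCompact_Icc (a := -M) (b := M)).exists_isMinOn
    ⟨0, by simpa using hM⟩ (hφ.contDiff_deriv.continuous.neg).continuousOn
  exact ⟨-deriv φ z₀, by linarith [hφ.deriv_neg hf z₀], fun z hz => hmin hz⟩

lemma exists_tails (hφ : PlanarFront f θ c φ) {σ : ℝ} (hσ : 0 < σ) :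
    ∃ M : ℝ, 0 ≤ M ∧ (∀ z, M ≤ z → φ z ≤ σ) ∧ ∀ z ≤ -M, 1 - σ ≤ φ z := by
  obtain ⟨a, ha⟩ := eventually_atTop.1 (hφ.lim_top.eventually_le_const hσ)
  obtain ⟨b, hb⟩ := eventually_atBot.1
    (hφ.lim_bot.eventually_const_le (show 1 - σ < 1 by linarith))
  refine ⟨max 0 (max a (-b)), le_max_left _ _, fun z hz => ha z ?_, fun z hz => hb z ?_⟩
  · exact (le_max_left _ _).trans ((le_max_right _ _).trans hz)
  · have : -b ≤ max 0 (max a (-b)) := (le_max_right _ _).trans (le_max_right _ _)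
    linarith

/-- The curvature term along the front, up to an integrable error and an exponentially small one. -/
lemma curvature_term_ge (hf : Bistable f θ) (hφ : PlanarFront f θ c φ) {d S r z : ℝ} (hd : 0 ≤ d)
    (hS : 0 < S) (hr : 0 < r) (hz : r - c * S ≤ z) :
    deriv φ z * (d / c ^ 2 / (S * √S)) + deriv φ 0 * (d / (c * S)) * Real.exp (-c * √S) ≤
      deriv φ z * (d / (c * S) - d / r) := by
  have hc := hφ.cpos
  have h1 := hφ.deriv_nonpos z
  have h2 := hφ.deriv_nonpos 0
  have hs : 0 < √S := Real.sqrt_pos.2 hS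
  have hss : √S * √S = S := Real.mul_self_sqrt hS.le
  have t1 : deriv φ z * (d / c ^ 2 / (S * √S)) ≤ 0 :=
    mul_nonpos_of_nonpos_of_nonneg h1 (by positivity)
  have t2 : deriv φ 0 * (d / (c * S)) * Real.exp (-c * √S) ≤ 0 :=
    mul_nonpos_of_nonpos_of_nonneg (mul_nonpos_of_nonpos_of_nonneg h2 (by positivity))
      (Real.exp_pos _).le
  rcases le_or_gt r (c * S) with hle | hgt
  · have : d / (c * S) ≤ d / r := by gcongr
    have : 0 ≤ deriv φ z * (d / (c * S) - d / r) := mul_nonneg_of_nonpos_of_nonpos h1 (by linarith)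
    linarith
  rcases le_or_gt (r - c * S) (√S) with hle' | hgt'
  · have : d / (c * S) - d / r ≤ d / c ^ 2 / (S * √S) := by
      have e : d / (c * S) - d / r = d * (r - c * S) / (c * S * r) := by field_simp
      have e2 : d / c ^ 2 / (S * √S) = d * √S / (c * S * (c * S)) := by
        rw [div_div, div_eq_div_iff (by positivity) (by positivity)]
        calc d * (c * S * (c * S)) = d * c ^ 2 * S * S := by ring
          _ = d * c ^ 2 * S * (√S * √S) := by rw [hss]
          _ = _ := by ring
      rw [e, e2]
      gcongr
    have := mul_le_mul_of_nonpos_left this h1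
    linarith
  · have hzs : √S ≤ z := by linarith
    have h3 := hφ.neg_deriv_le hf (hs.le.trans hzs)
    have h4 : Real.exp (-c * z) ≤ Real.exp (-c * √S) := by
      apply Real.exp_le_exp.2
      nlinarith
    have h5 : deriv φ 0 * Real.exp (-c * √S) ≤ deriv φ z := by
      have := mul_le_mul_of_nonpos_left h4 h2
      linarith
    have h6 : deriv φ z * (d / (c * S)) ≤ deriv φ z * (d / (c * S) - d / r) := by
      apply mul_le_mul_of_nonpos_left _ h1
      have : 0 ≤ d / r := by positivity
      linarith
    have h7 : deriv φ 0 * Real.exp (-c * √S) * (d / (c * S)) ≤ deriv φ z * (d / (c * S)) := by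
      gcongr
    have h8 : deriv φ 0 * (d / (c * S)) * Real.exp (-c * √S) =
      deriv φ 0 * Real.exp (-c * √S) * (d / (c * S)) := by ring
    linarith

/-- The residual of the radial supersolution is nonnegative at large times. -/
lemma exists_residual_nonneg (hf : Bistable f θ) (hφ : PlanarFront f θ c φ) (d : ℕ) (L : ℝ) :
    ∃ μ > 0, ∃ K ≥ 0, ∀ᶠ S in atTop, ∀ r > 0, ∀ z q p, z = r - c * S + d / c * Real.log S + K / √S →
      q = Real.exp (-c * √S) → p = 2 * Real.exp (-μ * (r - L)) →
      0 ≤ deriv φ z * (d / (c * S) - d / r - K / (2 * (S * √S))) - c / (2 * √S) * q - μ ^ 2 * p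
        + d / r * μ * p + f (φ z) - f (φ z + q + p) := by
  have hc := hφ.cpos
  obtain ⟨Λ, hΛ0, hΛ⟩ := hf.exists_lipschitz
  obtain ⟨m, hm, σ, hσ, -, hslope⟩ := hf.exists_slope
  obtain ⟨M, hM0, hMr, hMl⟩ := hφ.exists_tails hσ
  obtain ⟨k, hk, hkM⟩ := hφ.exists_pos_le_neg_deriv hf M hM0
  set μ := min 1 m with hμ
  have hμ0 : 0 < μ := lt_min one_pos hm
  have hμm : μ ^ 2 ≤ m := by
    have := min_le_left 1 m
    have := min_le_right 1 m
    nlinarith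
  set K : ℝ := 2 * (d / c ^ 2 + 1) with hK
  have hK0 : 0 ≤ K := by positivity
  refine ⟨μ, hμ0, K, hK0, ?_⟩
  have hsq : Tendsto (fun S : ℝ => √S) atTop atTop := Real.tendsto_sqrt_atTop
  have ev1 : ∀ᶠ y : ℝ in atTop, Real.exp (-c * y) ≤ σ / 2 := by
    have : Tendsto (fun y : ℝ => Real.exp (-c * y)) atTop (𝓝 0) := by
      refine Real.tendsto_exp_atBot.comp ?_
      exact tendsto_id.const_mul_atTop_of_neg (by linarith)
    exact this.eventually_le_const (by positivity)
  have ev2 : ∀ᶠ y : ℝ in atTop, Real.log 2 + μ * (M + L) + K * μ ≤ y * (μ * c * y - (c + μ * (2 * (d / c)))) := by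
    have : Tendsto (fun y : ℝ => y * (μ * c * y - (c + μ * (2 * (d / c))))) atTop atTop := by
      refine tendsto_id.atTop_mul_atTop₀ ?_
      refine tendsto_atTop_add_const_right _ _ ?_
      exact tendsto_id.const_mul_atTop (by positivity)
    exact this.eventually_ge_atTop _
  have ev3 : ∀ᶠ y : ℝ in atTop, -deriv φ 0 * (d / c) / y ≤ m / 4 :=
    (tendsto_const_nhds.div_atTop tendsto_id).eventually_le_const (by positivity)
  have ev4 : ∀ᶠ y : ℝ in atTop, c / 2 / y ≤ m / 4 :=
    (tendsto_const_nhds.div_atTop tendsto_id).eventually_le_const (by positivity)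
  have ev5 : ∀ᶠ y : ℝ in atTop, (m / 2 + m + 2 * Λ) * (y ^ 3 * Real.exp (-c * y)) ≤ k := by
    have h := (Real.tendsto_pow_mul_exp_neg_atTop_nhds_zero 3).comp
      (tendsto_id.const_mul_atTop hc)
    have h' : Tendsto (fun y : ℝ => (m / 2 + m + 2 * Λ) * (y ^ 3 * Real.exp (-c * y))) atTop
        (𝓝 ((m / 2 + m + 2 * Λ) * (1 / c ^ 3 * 0))) := by
      refine ((h.const_mul (1 / c ^ 3)).congr fun y => ?_).const_mul _
      simp only [Function.comp, id, mul_pow, neg_mul]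
      field_simp
    simp only [mul_zero] at h'
    exact h'.eventually_le_const hk
  filter_upwards [hsq.eventually ev1, hsq.eventually ev2, ev3, hsq.eventually ev4,
    hsq.eventually ev5, eventually_ge_atTop (1 : ℝ)] with S h1 h2 h3 h4 h5 hS1 r hr z q p hz hq hp
  have hS : 0 < S := by linarith
  have hs : 0 < √S := Real.sqrt_pos.2 hS
  have hs1 : 1 ≤ √S := Real.one_le_sqrt.2 hS1
  have hss : √S * √S = S := Real.mul_self_sqrt hS.le
  have hlog : Real.log S ≤ 2 * √S := by
    have : Real.log S = 2 * Real.log √S := by rw [Real.log_sqrt hS.le]; ring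
    rw [this]
    have := Real.log_le_sub_one_of_pos hs
    linarith
  have hlog0 : 0 ≤ Real.log S := Real.log_nonneg hS1
  have hq0 : 0 < q := hq ▸ Real.exp_pos _
  have hp0 : 0 < p := by rw [hp]; positivity
  have hKs : K / √S ≤ K := div_le_self hK0 hs1
  have hKs0 : 0 ≤ K / √S := by positivity
  have hdlog : d / c * Real.log S ≤ d / c * (2 * √S) := by gcongr
  have hdlog0 : 0 ≤ d / c * Real.log S := by positivity
  have hpq : -M ≤ z → p ≤ q := by
    intro hzM
    rw [hp, hq]
    have hr' : c * S - d / c * (2 * √S) - K - M - L ≤ r - L := by linarith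
    have h6 : μ * (c * S - d / c * (2 * √S) - K - M - L) ≤ μ * (r - L) := by gcongr
    have h7 : Real.log 2 + (-μ * (r - L)) ≤ -c * √S := by
      have : √S * (μ * c * √S - (c + μ * (2 * (d / c)))) =
        μ * c * S - (c + μ * (2 * (d / c))) * √S := by
          linear_combination μ * c * hss
      rw [this] at h2
      linarith
    calc 2 * Real.exp (-μ * (r - L)) = Real.exp (Real.log 2 + (-μ * (r - L))) := by
          rw [Real.exp_add, Real.exp_log two_pos]
      _ ≤ _ := Real.exp_le_exp.2 h7
  have hT := hφ.curvature_term_ge hf (Nat.cast_nonneg d) hS hr (z := z) (by linarith)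
  rw [← hq] at hT
  have hT2 : -(m / 4) * q ≤ deriv φ 0 * (d / (c * S)) * q := by
    gcongr
    have e : deriv φ 0 * (d / (c * S)) = -(-deriv φ 0 * (d / c) / S) := by
      rw [← div_div]; ring
    rw [e]
    linarith
  have hqt : c / (2 * √S) * q ≤ m / 4 * q := by
    rw [← div_div]; gcongr
  have hcurv : 0 ≤ d / r * μ * p := by positivity
  have hKe : K / (2 * (S * √S)) = d / c ^ 2 / (S * √S) + 1 / (S * √S) := by
    rw [hK, ← add_div, mul_div_mul_left _ _ two_ne_zero]
  have hexp : deriv φ z * (d / (c * S) - d / r - K / (2 * (S * √S))) =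
      deriv φ z * (d / (c * S) - d / r) - deriv φ z * (d / c ^ 2 / (S * √S))
        - deriv φ z * (1 / (S * √S)) := by rw [hKe]; ring
  have hμp : μ ^ 2 * p ≤ m * p := by gcongr
  have hpos : deriv φ z * (1 / (S * √S)) ≤ 0 :=
    mul_nonpos_of_nonpos_of_nonneg (hφ.deriv_nonpos z) (by positivity)
  have stable : (φ z + (q + p) ≤ 2 * σ ∨ 1 - σ ≤ φ z) → m * q + m * p ≤ f (φ z) - f (φ z + q + p) := by
    intro hcase
    have := hslope (φ z) (q + p) (by positivity) hcase
    rw [add_assoc]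
    linarith
  have hmq : 0 ≤ m * q := by positivity
  by_cases hzr : M ≤ z
  · have := stable (Or.inl (by have := hMr z hzr; have := hpq (by linarith); linarith))
    linarith
  by_cases hzl : z ≤ -M
  · have := stable (Or.inr (hMl z hzl))
    linarith
  push Not at hzr hzl
  have hpq' := hpq hzl.le
  have hLip : -(2 * Λ * q) ≤ f (φ z) - f (φ z + q + p) := by
    have h6 := hΛ (φ z) (φ z + q + p)
    have h7 : |φ z - (φ z + q + p)| = q + p := by
      rw [show φ z - (φ z + q + p) = -(q + p) by ring, abs_neg, abs_of_pos (by linarith)]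
    rw [h7] at h6
    have h8 := neg_abs_le (f (φ z) - f (φ z + q + p))
    have h9 : Λ * (q + p) ≤ Λ * (2 * q) := by gcongr; linarith
    linarith
  have hmain : (m / 2 + m + 2 * Λ) * q ≤ -deriv φ z * (1 / (S * √S)) := by
    have hk' := hkM z ⟨hzl.le, hzr.le⟩
    have e : √S ^ 3 = S * √S := by linear_combination √S * hss
    rw [e, ← hq] at h5
    have h6 : (m / 2 + m + 2 * Λ) * q ≤ k * (1 / (S * √S)) := by
      rw [mul_one_div, le_div_iff₀ (by positivity)]
      linarith
    exact h6.trans (by gcongr)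
  have hmp : m * p ≤ m * q := by gcongr
  linarith

end PlanarFront

/-- A solution of `u_t = Δu + f(u)` in the cone with values in `[0,1]`, satisfying the Neumann
condition on the lateral boundary at distance at least `L` from the vertex. -/
structure ConeSol (d : ℕ) (T L : ℝ) (f : ℝ → ℝ) (U : ℝ → Euc d → ℝ) : Prop where
  Tpos : 0 < T
  le_one : ∀ t, ∀ x ∈ cone d T, U t x ≤ 1
  diff : ∀ x ∈ cone d T, Differentiable ℝ fun t => U t x
  smooth : ∀ t, ContDiffOn ℝ 2 (U t) (cone d T)
  pde : ∀ t, ∀ x ∈ coneInt d T, deriv (fun s => U s x) t = lapW (cone d T) (U t) x + f (U t x)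
  lat : ∀ t, ∀ x ∈ cone d T, L ≤ ‖x‖ → rho T x = 0 →
    fderivWithin ℝ (U t) (cone d T) x (gradRho T x) = 0

/-- A radial supersolution of `u_t = Δu + f(u)` that is at least `1` for radii up to `R₁`. -/
structure RadialSuper (d : ℕ) (L R₁ : ℝ) (f : ℝ → ℝ) (P : ℝ → ℝ → ℝ) : Prop where
  Lpos : 0 < L
  lt : L < R₁
  nonneg : ∀ t ≥ 0, ∀ r, 0 ≤ P t r
  one_le : ∀ t ≥ 0, ∀ r ≤ R₁, 1 ≤ P t r
  diff : ∀ t ≥ 0, ∀ r, DifferentiableAt ℝ (fun s => P s r) t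
  smooth : ∀ t ≥ 0, ContDiff ℝ 2 (P t)
  super : ∀ t ≥ 0, ∀ r > 0, deriv (deriv (P t)) r + d / r * deriv (P t) r + f (P t r) ≤
    deriv (fun s => P s r) t

lemma hasDerivAt_ite_nonpos {W : ℝ → ℝ} (h0 : W 0 = 0) (hd : HasDerivAt W 0 0) :
    HasDerivAt (fun s => if s ≤ 0 then 0 else W s) 0 0 := by
  rw [hasDerivAt_iff_isLittleO] at hd ⊢
  refine Asymptotics.IsBigO.trans_isLittleO (Asymptotics.IsBigO.of_bound 1 ?_) hd
  refine Eventually.of_forall fun s => ?_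
  simp only [h0, smul_zero, sub_zero, le_refl, if_true, one_mul]
  split_ifs
  · simp
  · rfl

namespace ConeSol

variable {d : ℕ} {T L R₁ R₂ Λ : ℝ} {f : ℝ → ℝ} {U : ℝ → Euc d → ℝ} {P : ℝ → ℝ → ℝ}

/-- The rescaled cube of the positive part of `U - P`, extended by zero to negative times. -/
def defect (Λ : ℝ) (U : ℝ → Euc d → ℝ) (P : ℝ → ℝ → ℝ) (t : ℝ) (x : Euc d) : ℝ :=
  if t ≤ 0 then 0 else Real.exp (-(3 * Λ) * t) * cubePos (U t x - P t ‖x‖)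

lemma defect_of_nonpos {t : ℝ} (ht : t ≤ 0) : defect Λ U P t = fun _ => 0 := by
  funext x; simp [defect, ht]

lemma defect_of_pos {t : ℝ} (ht : 0 < t) :
    defect Λ U P t = fun x => Real.exp (-(3 * Λ) * t) * cubePos (U t x - P t ‖x‖) := by
  funext x; simp [defect, not_le.2 ht]

lemma defect_eq_zero (hU : ConeSol d T L f U) {t : ℝ} {x : Euc d} (hx : x ∈ cone d T)
    (h : 0 < t → 1 ≤ P t ‖x‖) : defect Λ U P t x = 0 := by
  rcases le_or_gt t 0 with ht | ht
  · rw [defect_of_nonpos ht]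
  · rw [defect_of_pos ht]
    simp only
    rw [cubePos_of_nonpos, mul_zero]
    linarith [hU.le_one t x hx, h ht]

lemma defect_eventuallyEq (hU : ConeSol d T L f U) (hP : RadialSuper d L R₁ f P) {t : ℝ}
    {x : Euc d} (h : ‖x‖ < R₁) : defect Λ U P t =ᶠ[𝓝[cone d T] x] fun _ => 0 := by
  filter_upwards [self_mem_nhdsWithin, mem_nhdsWithin_of_mem_nhds
    ((isOpen_lt continuous_norm continuous_const).mem_nhds h)] with y hy hy'
  exact hU.defect_eq_zero hy fun ht => hP.one_le t ht.le _ (le_of_lt hy')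

lemma contDiffWithinAt_sub (hU : ConeSol d T L f U) (hP : RadialSuper d L R₁ f P) {t : ℝ}
    (ht : 0 ≤ t) {x : Euc d} (hx : x ∈ cone d T) (h0 : x ≠ 0) :
    ContDiffWithinAt ℝ 2 (fun y => U t y - P t ‖y‖) (cone d T) x :=
  (hU.smooth t x hx).sub
    ((((hP.smooth t ht).contDiffAt.comp x (contDiffAt_norm' h0)).contDiffWithinAt))

lemma hasDerivAt_weighted (hU : ConeSol d T L f U) (hP : RadialSuper d L R₁ f P) {t : ℝ}
    (ht : 0 ≤ t) {x : Euc d} (hx : x ∈ cone d T) :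
    HasDerivAt (fun s => Real.exp (-(3 * Λ) * s) * cubePos (U s x - P s ‖x‖))
      (Real.exp (-(3 * Λ) * t) * (3 * (max (U t x - P t ‖x‖) 0) ^ 2 *
        (deriv (fun s => U s x) t - deriv (fun s => P s ‖x‖) t)
          - 3 * Λ * cubePos (U t x - P t ‖x‖))) t := by
  have h1 := (hU.diff x hx t).hasDerivAt.fun_sub (hP.diff t ht ‖x‖).hasDerivAt
  have h2 := HasDerivAt.comp t (h₂ := cubePos) (hasDerivAt_cubePos (U t x - P t ‖x‖)) h1
  have h3 := ((hasDerivAt_id t).const_mul (-(3 * Λ))).exp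
  have h4 := h3.fun_mul h2
  refine h4.congr_deriv ?_
  simp only [id, Function.comp]
  ring

lemma differentiable_defect (hU : ConeSol d T L f U) (hP : RadialSuper d L R₁ f P)
    (hinit : ∀ x ∈ cone d T, U 0 x ≤ P 0 ‖x‖) {x : Euc d} (hx : x ∈ cone d T) (t : ℝ) :
    DifferentiableAt ℝ (fun t => defect Λ U P t x) t ∧
      (t ≤ 0 → deriv (fun t => defect Λ U P t x) t = 0) := by
  rcases lt_trichotomy t 0 with ht | rfl | ht
  · have : (fun t => defect Λ U P t x) =ᶠ[𝓝 t] fun _ => 0 := by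
      filter_upwards [Iio_mem_nhds ht] with s hs
      rw [defect_of_nonpos (le_of_lt hs)]
    refine ⟨this.differentiableAt_iff.2 (differentiableAt_const _), fun _ => ?_⟩
    rw [this.deriv_eq, deriv_const]
  · have hn : U 0 x - P 0 ‖x‖ ≤ 0 := by linarith [hinit x hx]
    have h := hU.hasDerivAt_weighted hP (Λ := Λ) le_rfl hx
    rw [cubePos_of_nonpos hn, max_eq_right hn] at h
    have h' := hasDerivAt_ite_nonpos (W := fun s =>
      Real.exp (-(3 * Λ) * s) * cubePos (U s x - P s ‖x‖)) (by simp [cubePos_of_nonpos hn])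
        (h.congr_deriv (by simp))
    exact ⟨h'.differentiableAt, fun _ => h'.deriv⟩
  · refine ⟨?_, fun h => absurd h (not_le.2 ht)⟩
    have : (fun t => defect Λ U P t x) =ᶠ[𝓝 t]
        fun s => Real.exp (-(3 * Λ) * s) * cubePos (U s x - P s ‖x‖) := by
      filter_upwards [Ioi_mem_nhds ht] with s hs
      rw [defect_of_pos hs]
    exact this.differentiableAt_iff.2 (hU.hasDerivAt_weighted hP ht.le hx).differentiableAt

lemma contDiffOn_defect (hU : ConeSol d T L f U) (hP : RadialSuper d L R₁ f P) (t : ℝ) :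
    ContDiffOn ℝ 2 (defect Λ U P t) (cone d T) := by
  intro x hx
  rcases lt_or_ge ‖x‖ R₁ with h | h
  · exact contDiffWithinAt_const.congr_of_eventuallyEq (hU.defect_eventuallyEq hP h)
      ((hU.defect_eventuallyEq hP h).self_of_nhdsWithin hx)
  have h0 : x ≠ 0 := by
    rintro rfl
    rw [norm_zero] at h
    linarith [hP.Lpos, hP.lt]
  rcases le_or_gt t 0 with ht | ht
  · rw [defect_of_nonpos ht]; exact contDiffWithinAt_const
  · rw [defect_of_pos ht]
    exact contDiffWithinAt_const.mul
      (contDiff_cubePos.contDiffAt.comp_contDiffWithinAt x (hU.contDiffWithinAt_sub hP ht.le hx h0))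

lemma deriv_defect_le (hU : ConeSol d T L f U) (hP : RadialSuper d L R₁ f P)
    (hf : ∀ a b, |f a - f b| ≤ Λ * |a - b|)
    (hinit : ∀ x ∈ cone d T, U 0 x ≤ P 0 ‖x‖) {x : Euc d} (hx : x ∈ coneInt d T) (t : ℝ) :
    deriv (fun t => defect Λ U P t x) t ≤ lapW (cone d T) (defect Λ U P t) x := by
  have hxC := coneInt_subset_cone hx
  rw [lapW_eq_lap (cone_mem_nhds hx)]
  rcases le_or_gt t 0 with ht | ht
  · rw [(hU.differentiable_defect hP hinit hxC t).2 ht, defect_of_nonpos ht, lap_const]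
  rcases lt_or_ge ‖x‖ R₁ with h | h
  · have e := hU.defect_eventuallyEq hP (Λ := Λ) (t := t) h
    rw [nhdsWithin_eq_nhds.2 (cone_mem_nhds hx)] at e
    rw [lap_congr e, lap_const]
    have : (fun t => defect Λ U P t x) =ᶠ[𝓝 t] fun _ => 0 := by
      refine Eventually.of_forall fun s => ?_
      exact hU.defect_eq_zero hxC fun hs => hP.one_le s hs.le _ h.le
    rw [this.deriv_eq, deriv_const]
  have h0 : x ≠ 0 := by
    rintro rfl
    rw [norm_zero] at h
    linarith [hP.Lpos, hP.lt]
  have hev : (fun t => defect Λ U P t x) =ᶠ[𝓝 t]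
      fun s => Real.exp (-(3 * Λ) * s) * cubePos (U s x - P s ‖x‖) := by
    filter_upwards [Ioi_mem_nhds ht] with s hs
    rw [defect_of_pos hs]
  have hws := (hU.contDiffWithinAt_sub hP ht.le hxC h0).contDiffAt (cone_mem_nhds hx)
  have hcs : ContDiffAt ℝ 2 (fun y => cubePos (U t y - P t ‖y‖)) x :=
    contDiff_cubePos.contDiffAt.comp x hws
  have hPs : ContDiffAt ℝ 2 (fun y : Euc d => P t ‖y‖) x :=
    (hP.smooth t ht.le).contDiffAt.comp x (contDiffAt_norm' h0)
  rw [hev.deriv_eq, (hU.hasDerivAt_weighted hP ht.le hxC).deriv, defect_of_pos ht,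
    lap_const_mul _ hcs, lap_comp hws contDiff_cubePos.contDiffAt,
    lap_sub ((hU.smooth t).contDiffAt_coneInt hx) hPs,
    lap_radial h0 (hP.smooth t ht.le).contDiffAt,
    (hasDerivAt_deriv_cubePos _).deriv, deriv_cubePos, hU.pde t x hx,
    lapW_eq_lap (cone_mem_nhds hx)]
  beta_reduce
  have hsup := hP.super t ht.le ‖x‖ (norm_pos_iff.2 h0)
  gcongr
  set w := U t x - P t ‖x‖ with hw
  have hsum : 0 ≤ ∑ i, (fderiv ℝ (fun y => U t y - P t ‖y‖) x (stdVec i)) ^ 2 :=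
    Finset.sum_nonneg fun i _ => sq_nonneg _
  rcases le_or_gt w 0 with hw0 | hw0
  · simp [max_eq_right hw0, cubePos_of_nonpos hw0]
  · have h6 : 0 ≤ 6 * max w 0 * ∑ i, (fderiv ℝ (fun y => U t y - P t ‖y‖) x (stdVec i)) ^ 2 := by
      positivity
    have hL := (le_abs_self _).trans (hf (U t x) (P t ‖x‖))
    rw [← hw, abs_of_pos hw0] at hL
    rw [cubePos, max_eq_left hw0.le] at *
    have h7 : 3 * w ^ 2 * (lap (U t) x + f (U t x) - deriv (fun s => P s ‖x‖) t) ≤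
        3 * w ^ 2 * ((lap (U t) x - (deriv (deriv (P t)) ‖x‖ + d / ‖x‖ * deriv (P t) ‖x‖)) +
          Λ * w) := by
      gcongr
      linarith
    nlinarith

lemma fderivWithin_defect (hU : ConeSol d T L f U) (hP : RadialSuper d L R₁ f P) (t : ℝ)
    {x : Euc d} (hx : x ∈ cone d T) (hρ : rho T x = 0) :
    fderivWithin ℝ (defect Λ U P t) (cone d T) x (gradRho T x) = 0 := by
  rcases le_or_gt t 0 with ht | ht
  · rw [defect_of_nonpos ht]; simp
  rcases lt_or_ge ‖x‖ R₁ with h | h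
  · rw [(hU.defect_eventuallyEq hP h).fderivWithin_eq
      ((hU.defect_eventuallyEq hP h).self_of_nhdsWithin hx)]
    simp
  have h0 : x ≠ 0 := by
    rintro rfl
    rw [norm_zero] at h
    linarith [hP.Lpos, hP.lt]
  have hn := ((contDiffAt_norm' h0).differentiableAt (by simp)).hasFDerivAt
  have h1 := (((hP.smooth t ht.le).differentiable (by norm_num) ‖x‖).hasDerivAt.comp_hasFDerivAt x
    hn).hasFDerivWithinAt (s := cone d T)
  have h2 := ((hU.smooth t).differentiableOn (by norm_num) x hx).hasFDerivWithinAt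
  have h3 := (hasDerivAt_cubePos (U t x - P t ‖x‖)).comp_hasFDerivWithinAt x (h2.sub h1)
  have h4 := (h3.const_mul (Real.exp (-(3 * Λ) * t))).fderivWithin
    (uniqueDiffOn_cone hU.Tpos x hx)
  rw [defect_of_pos ht]
  have h5 : fderivWithin ℝ (fun x => Real.exp (-(3 * Λ) * t) * cubePos (U t x - P t ‖x‖))
    (cone d T) x = _ := h4
  rw [h5]
  simp only [_root_.smul_apply, _root_.sub_apply, hU.lat t x hx (hP.lt.le.trans h) hρ,
    fderiv_norm_apply h0, inner_self_gradRho, hρ]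
  simp

/-- Comparison with a radial supersolution that is at least `1` at large radii. -/
lemma le_of_one_le (hU : ConeSol d T L f U) (hP : RadialSuper d L R₁ f P) (hΛ : 0 ≤ Λ)
    (hf : ∀ a b, |f a - f b| ≤ Λ * |a - b|)
    (hinit : ∀ x ∈ cone d T, U 0 x ≤ P 0 ‖x‖) (hR₂ : 0 ≤ R₂)
    (hlarge : ∀ t ≥ 0, ∀ r ≥ R₂, 1 ≤ P t r) {t : ℝ} (ht : 0 ≤ t) {x : Euc d}
    (hx : x ∈ cone d T) : U t x ≤ P t ‖x‖ := by
  have hsub : SubSol d T R₁ R₂ 1 (defect Λ U P) :=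
    { Tpos := hU.Tpos
      R₁pos := hP.Lpos.trans hP.lt
      R₂nonneg := hR₂
      nonneg := fun t x hx => by
        unfold defect
        split_ifs
        · rfl
        · exact mul_nonneg (Real.exp_pos _).le (cubePos_nonneg _)
      bdd := fun t x hx => by
        unfold defect
        split_ifs with h
        · exact zero_le_one
        · push Not at h
          refine mul_le_one₀ (Real.exp_le_one_iff.2 ?_) (cubePos_nonneg _) ?_
          · have : 0 ≤ 3 * Λ * t := by positivity
            linarith
          · refine pow_le_one₀ (le_max_right _ _) (max_le ?_ zero_le_one)
            linarith [hU.le_one t x hx, hP.nonneg t h.le ‖x‖]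
      zero_small := fun t x hx h => hU.defect_eq_zero hx fun ht => hP.one_le t ht.le _ h
      zero_large := fun t x hx h => hU.defect_eq_zero hx fun ht => hlarge t ht.le _ h
      diff := fun x hx t => (hU.differentiable_defect hP hinit hx t).1
      smooth := hU.contDiffOn_defect hP
      sub := fun t x hx => hU.deriv_defect_le hP hf hinit hx t
      lat := fun t x hx hρ => hU.fderivWithin_defect hP t hx hρ
      init := fun x _ => by rw [defect_of_nonpos le_rfl] }
  rcases ht.eq_or_lt with rfl | ht
  · exact hinit x hx
  have h := hsub.nonpos ht.le hx
  rw [defect_of_pos ht] at h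
  have h2 := (mul_nonpos_iff_pos_imp_nonpos.1 h).1 (Real.exp_pos _)
  have h3 := nonpos_of_cubePos_eq_zero (le_antisymm h2 (cubePos_nonneg _))
  linarith

end ConeSol

namespace RadialSuper

variable {d : ℕ} {L R₁ Λ : ℝ} {f : ℝ → ℝ} {P : ℝ → ℝ → ℝ}

lemma add_growth (hP : RadialSuper d L R₁ f P) (hf : ∀ a b, |f a - f b| ≤ Λ * |a - b|)
    {η : ℝ} (hη : 0 ≤ η) :
    RadialSuper d L R₁ f
      fun t r => P t r + η * Real.exp ((2 * (d + 1) + Λ) * t) * (1 + r ^ 2) where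
  Lpos := hP.Lpos
  lt := hP.lt
  nonneg t ht r := add_nonneg (hP.nonneg t ht r) (by positivity)
  one_le t ht r hr := (hP.one_le t ht r hr).trans (le_add_of_nonneg_right (by positivity))
  diff t ht r := by
    refine (hP.diff t ht r).add ?_
    fun_prop
  smooth t ht := by
    refine (hP.smooth t ht).add ?_
    fun_prop
  super t ht r hr := by
    set κ : ℝ := 2 * (d + 1) + Λ with hκ
    set A := η * Real.exp (κ * t) with hA
    have hA0 : 0 ≤ A := by positivity
    have hd1 : deriv (fun r => P t r + A * (1 + r ^ 2)) = fun r => deriv (P t) r + A * (2 * r) := by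
      funext y
      have h1 := ((hP.smooth t ht).differentiable (by norm_num) y).hasDerivAt
      have h2 := (((hasDerivAt_pow 2 y).const_add 1).const_mul A)
      rw [(h1.fun_add h2).deriv]
      norm_num
    have hd2 : deriv (fun r => deriv (P t) r + A * (2 * r)) r = deriv (deriv (P t)) r + A * 2 := by
      have hs : ContDiff ℝ 1 (deriv (P t)) := by
        have h : ContDiff ℝ (1 + 1) (P t) := by simpa [one_add_one_eq_two] using hP.smooth t ht
        exact (contDiff_succ_iff_deriv.1 h).2.2
      have h1 := (hs.differentiable (by norm_num) r).hasDerivAt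
      have h2 := (((hasDerivAt_id r).const_mul 2).const_mul A)
      have := (h1.fun_add h2).deriv
      simpa using this
    have hd3 : deriv (fun s => P s r + η * Real.exp (κ * s) * (1 + r ^ 2)) t =
        deriv (fun s => P s r) t + κ * A * (1 + r ^ 2) := by
      have h1 := (hP.diff t ht r).hasDerivAt
      have h2 := ((((hasDerivAt_id t).const_mul κ).exp.const_mul η).mul_const (1 + r ^ 2))
      refine (h1.fun_add h2).deriv.trans ?_
      simp only [id, hA]
      ring
    rw [hd1, hd2, hd3]
    have hs := hP.super t ht r hr
    have hL := (le_abs_self _).trans (hf (P t r + A * (1 + r ^ 2)) (P t r))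
    rw [add_sub_cancel_left, abs_of_nonneg (by positivity)] at hL
    have e : (d : ℝ) / r * (deriv (P t) r + A * (2 * r)) = d / r * deriv (P t) r + 2 * d * A := by
      field_simp
    rw [e]
    have h3 : 2 * (d + 1) * A ≤ 2 * (d + 1) * A * (1 + r ^ 2) :=
      le_mul_of_one_le_right (by positivity) (by nlinarith [sq_nonneg r])
    have e2 : κ * A * (1 + r ^ 2) = 2 * (d + 1) * A * (1 + r ^ 2) + Λ * (A * (1 + r ^ 2)) := by
      rw [hκ]; ring
    rw [e2]
    linarith

end RadialSuper

/-- Comparison principle in the cone with radial supersolutions. -/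
theorem ConeSol.le_radialSuper {d : ℕ} {T L R₁ Λ : ℝ} {f : ℝ → ℝ} {U : ℝ → Euc d → ℝ}
    {P : ℝ → ℝ → ℝ} (hU : ConeSol d T L f U) (hP : RadialSuper d L R₁ f P) (hΛ : 0 ≤ Λ)
    (hf : ∀ a b, |f a - f b| ≤ Λ * |a - b|) (hinit : ∀ x ∈ cone d T, U 0 x ≤ P 0 ‖x‖)
    {t : ℝ} (ht : 0 ≤ t) {x : Euc d} (hx : x ∈ cone d T) : U t x ≤ P t ‖x‖ := by
  refine le_of_forall_pos_le_add fun ε hε => ?_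
  set D := Real.exp ((2 * (d + 1) + Λ) * t) * (1 + ‖x‖ ^ 2) with hD
  have hD0 : 0 < D := by positivity
  have hη : 0 < ε / D := by positivity
  have h := hU.le_of_one_le (R₂ := 1 / √(ε / D)) (hP.add_growth hf hη.le) hΛ hf
    (fun y hy => (hinit y hy).trans (le_add_of_nonneg_right (by positivity))) (by positivity)
    (fun s hs r hr => ?_) ht hx
  · refine h.trans (le_of_eq ?_)
    rw [mul_assoc, ← hD]
    field_simp
  · have h1 : 1 ≤ Real.exp ((2 * (d + 1) + Λ) * s) := Real.one_le_exp (by positivity)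
    have h2 : 1 ≤ ε / D * (1 + r ^ 2) := by
      have h3 : 1 ≤ r * √(ε / D) := (div_le_iff₀ (Real.sqrt_pos.2 hη)).1 hr
      have h4 : 1 ≤ (r * √(ε / D)) ^ 2 := one_le_pow₀ h3
      rw [mul_pow, Real.sq_sqrt hη.le] at h4
      nlinarith
    have h5 : ε / D * (1 + r ^ 2) ≤ ε / D * Real.exp ((2 * (d + 1) + Λ) * s) * (1 + r ^ 2) := by
      gcongr
      exact le_mul_of_one_le_right hη.le h1
    have := hP.nonneg s hs r
    linarith

/-- The radial supersolution: a logarithmically delayed front with exponentially small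
corrections. -/
def frontSuper (d : ℕ) (c L μ K τ : ℝ) (φ : ℝ → ℝ) (t r : ℝ) : ℝ :=
  φ (r - c * (t + τ) + d / c * Real.log (t + τ) + K / √(t + τ)) + Real.exp (-c * √(t + τ))
    + 2 * Real.exp (-μ * (r - L))

namespace PlanarFront

variable {f φ : ℝ → ℝ} {θ c : ℝ}

lemma hasDerivAt_frontSuper_time (hφ : PlanarFront f θ c φ) (d : ℕ) (L μ K τ t r : ℝ)
    (hS : 0 < t + τ) :
    HasDerivAt (fun s => frontSuper d c L μ K τ φ s r)
      (deriv φ (r - c * (t + τ) + d / c * Real.log (t + τ) + K / √(t + τ)) *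
        (-c + d / (c * (t + τ)) - K / (2 * ((t + τ) * √(t + τ))))
        - c / (2 * √(t + τ)) * Real.exp (-c * √(t + τ))) t := by
  have hs : 0 < √(t + τ) := Real.sqrt_pos.2 hS
  have hss : √(t + τ) * √(t + τ) = t + τ := Real.mul_self_sqrt hS.le
  have h0 : HasDerivAt (fun s => s + τ) 1 t := (hasDerivAt_id t).add_const τ
  have hsq := h0.sqrt hS.ne'
  have hlog := h0.log hS.ne'
  have hinv := (hasDerivAt_const t K).fun_div hsq hs.ne'
  have hz := (((h0.const_mul c).const_sub r).fun_add (hlog.const_mul (d / c))).fun_add hinv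
  have hφz := HasDerivAt.comp t (h₂ := φ) (hφ.hasDerivAt _) hz
  have hq := (hsq.const_mul (-c)).exp
  have hc := hφ.cpos
  have hall := (hφz.fun_add hq).add_const (2 * Real.exp (-μ * (r - L)))
  refine hall.congr_deriv ?_
  have e : -(c * 1) + d / c * (1 / (t + τ)) +
      (0 * √(t + τ) - K * (1 / (2 * √(t + τ)))) / √(t + τ) ^ 2 =
      -c + d / (c * (t + τ)) - K / (2 * ((t + τ) * √(t + τ))) := by
    rw [sq, hss]
    field_simp
    ring
  rw [e]
  ring

lemma hasDerivAt_frontSuper (hφ : PlanarFront f θ c φ) (d : ℕ) (L μ K τ t r : ℝ) :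
    HasDerivAt (frontSuper d c L μ K τ φ t)
      (deriv φ (r - c * (t + τ) + d / c * Real.log (t + τ) + K / √(t + τ))
        - 2 * μ * Real.exp (-μ * (r - L))) r := by
  have hz : HasDerivAt (fun r => r - c * (t + τ) + d / c * Real.log (t + τ) + K / √(t + τ)) 1 r :=
    (((hasDerivAt_id r).sub_const _).add_const _).add_const _
  have h1 := HasDerivAt.comp r (h₂ := φ) (hφ.hasDerivAt _) hz
  have h2 := ((((hasDerivAt_id r).sub_const L).const_mul (-μ)).exp).const_mul 2
  refine ((h1.add_const (Real.exp (-c * √(t + τ)))).fun_add h2).congr_deriv ?_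
  simp only [id]
  ring

lemma hasDerivAt_deriv_frontSuper (hφ : PlanarFront f θ c φ) (d : ℕ) (L μ K τ t r : ℝ) :
    HasDerivAt (deriv (frontSuper d c L μ K τ φ t))
      (-c * deriv φ (r - c * (t + τ) + d / c * Real.log (t + τ) + K / √(t + τ))
        - f (φ (r - c * (t + τ) + d / c * Real.log (t + τ) + K / √(t + τ)))
        + 2 * μ ^ 2 * Real.exp (-μ * (r - L))) r := by
  have e : deriv (frontSuper d c L μ K τ φ t) = fun r =>
      deriv φ (r - c * (t + τ) + d / c * Real.log (t + τ) + K / √(t + τ))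
        - 2 * μ * Real.exp (-μ * (r - L)) :=
    funext fun r => (hφ.hasDerivAt_frontSuper d L μ K τ t r).deriv
  rw [e]
  have hz : HasDerivAt (fun r => r - c * (t + τ) + d / c * Real.log (t + τ) + K / √(t + τ)) 1 r :=
    (((hasDerivAt_id r).sub_const _).add_const _).add_const _
  have h1 := HasDerivAt.comp r (h₂ := deriv φ) (hφ.hasDerivAt_deriv _) hz
  have h2 := ((((hasDerivAt_id r).sub_const L).const_mul (-μ)).exp).const_mul (2 * μ)
  refine (h1.fun_sub h2).congr_deriv ?_
  simp only [id]
  ring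

lemma contDiff_frontSuper (hφ : PlanarFront f θ c φ) (d : ℕ) (L μ K τ t : ℝ) :
    ContDiff ℝ 2 (frontSuper d c L μ K τ φ t) := by
  have h1 : ContDiff ℝ 2 fun r => φ (r - c * (t + τ) + d / c * Real.log (t + τ) + K / √(t + τ)) :=
    hφ.smooth.comp (by fun_prop)
  exact (h1.add contDiff_const).add (by fun_prop)

lemma exists_radialSuper (hf : Bistable f θ) (hφ : PlanarFront f θ c φ) (d : ℕ) {L : ℝ}
    (hL : 0 < L) : ∃ μ > 0, ∃ K ≥ 0, ∀ᶠ τ in atTop,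
      RadialSuper d L (L + Real.log 2 / μ) f (frontSuper d c L μ K τ φ) := by
  obtain ⟨μ, hμ, K, hK, hev⟩ := hφ.exists_residual_nonneg hf d L
  refine ⟨μ, hμ, K, hK, ?_⟩
  have hc := hφ.cpos
  filter_upwards [eventually_forall_ge_atTop.2 hev, eventually_gt_atTop 0] with τ hres hτ
  have hlow : ∀ t r, 2 * Real.exp (-μ * (r - L)) ≤ frontSuper d c L μ K τ φ t r := by
    intro t r
    have h1 := (hφ.mem (r - c * (t + τ) + d / c * Real.log (t + τ) + K / √(t + τ))).1
    have h2 := Real.exp_pos (-c * √(t + τ))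
    unfold frontSuper
    linarith
  exact
    { Lpos := hL
      lt := by
        have : 0 < Real.log 2 / μ := div_pos (Real.log_pos one_lt_two) hμ
        linarith
      nonneg := fun t _ r => le_trans (by positivity) (hlow t r)
      one_le := fun t _ r hr => by
        refine le_trans ?_ (hlow t r)
        have h1 : μ * (r - L) ≤ Real.log 2 := by
          have : r - L ≤ Real.log 2 / μ := by linarith
          rw [le_div_iff₀ hμ] at this
          linarith
        have h2 : Real.exp (-Real.log 2) ≤ Real.exp (-μ * (r - L)) :=
          Real.exp_le_exp.2 (by linarith)
        rw [Real.exp_neg, Real.exp_log two_pos] at h2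
        linarith
      diff := fun t ht r =>
        (hφ.hasDerivAt_frontSuper_time d L μ K τ t r (by linarith)).differentiableAt
      smooth := fun t _ => hφ.contDiff_frontSuper d L μ K τ t
      super := fun t ht r hr => by
        rw [(hφ.hasDerivAt_frontSuper_time d L μ K τ t r (by linarith)).deriv,
          (hφ.hasDerivAt_deriv_frontSuper d L μ K τ t r).deriv,
          (hφ.hasDerivAt_frontSuper d L μ K τ t r).deriv, frontSuper]
        have := hres (t + τ) (by linarith) r hr _ _ _ rfl rfl rfl
        linarith }

end PlanarFront

namespace IsFunnel

variable {d : ℕ} {R α L : ℝ} {h : ℝ → ℝ}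

lemma cos_pos (hΩ : IsFunnel d R α L h) : 0 < Real.cos α :=
  Real.cos_pos_of_mem_Ioo ⟨by linarith [hΩ.αmem.1, Real.pi_pos], hΩ.αmem.2⟩

lemma L_pos (hΩ : IsFunnel d R α L h) : 0 < L := hΩ.Rpos.trans hΩ.RL

lemma differentiable (hΩ : IsFunnel d R α L h) : Differentiable ℝ h :=
  hΩ.smooth.differentiable (by norm_num)

lemma monotone (hΩ : IsFunnel d R α L h) : Monotone h :=
  monotone_of_deriv_nonneg hΩ.differentiable hΩ.deriv_nonneg

lemma mul_tan_le (hΩ : IsFunnel d R α L h) (s : ℝ) : s * Real.tan α ≤ h s := by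
  rcases le_or_gt (L * Real.cos α) s with hs | hs
  · exact (hΩ.right s hs).ge
  · have h1 := convex_univ.image_sub_le_mul_sub_of_deriv_le
      hΩ.differentiable.continuous.continuousOn hΩ.differentiable.differentiableOn
      (fun x _ => hΩ.deriv_le x) s (mem_univ _) (L * Real.cos α) (mem_univ _) hs.le
    rw [hΩ.right _ le_rfl] at h1
    linarith

lemma coneInt_subset (hΩ : IsFunnel d R α L h) : coneInt d (Real.tan α) ⊆ funnel d h := by
  intro x hx
  simp only [coneInt, funnel, mem_ofPred_eq] at hx ⊢
  exact hx.trans_le (hΩ.mul_tan_le _)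

lemma cone_subset (hΩ : IsFunnel d R α L h) (hT : 0 < Real.tan α) :
    cone d (Real.tan α) ⊆ closure (funnel d h) :=
  (cone_subset_closure hT).trans (closure_mono hΩ.coneInt_subset)

lemma primeNorm_le (hΩ : IsFunnel d R α L h) {x : Euc d} (hx : x ∈ closure (funnel d h)) :
    primeNorm x ≤ h (x 0) := by
  have hc : IsClosed {x : Euc d | primeNorm x ≤ h (x 0)} :=
    isClosed_le continuous_primeNorm (hΩ.differentiable.continuous.comp (by fun_prop))
  refine closure_minimal (fun y hy => ?_) hc hx
  simp only [funnel, mem_ofPred_eq] at hy ⊢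
  exact hy.le

lemma mem_cone (hΩ : IsFunnel d R α L h) {x : Euc d} (hx : x ∈ closure (funnel d h))
    (h0 : 0 < x 0) (hL : L ≤ ‖x‖) : x ∈ cone d (Real.tan α) := by
  have hp := hΩ.primeNorm_le hx
  have hcos := hΩ.cos_pos
  have hle : L * Real.cos α ≤ x 0 := by
    by_contra hcon
    push Not at hcon
    have h1 := hp.trans (hΩ.monotone hcon.le)
    rw [hΩ.right _ le_rfl, mul_assoc, mul_comm (Real.cos α), Real.tan_mul_cos hcos.ne'] at h1
    have h2 := primeNorm_nonneg x
    have h3 := primeNorm_sq x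
    have h4 : primeNorm x ^ 2 ≤ (L * Real.sin α) ^ 2 := by gcongr
    have h5 : x 0 ^ 2 < (L * Real.cos α) ^ 2 := by gcongr
    have h6 : L ^ 2 ≤ ‖x‖ ^ 2 := by gcongr; exact hΩ.L_pos.le
    have h7 := Real.sin_sq_add_cos_sq α
    have h8 : (L * Real.sin α) ^ 2 + (L * Real.cos α) ^ 2 = L ^ 2 := by
      rw [mul_pow, mul_pow, ← mul_add, h7, mul_one]
    linarith
  rw [hΩ.right _ hle] at hp
  simpa only [cone, mem_ofPred_eq] using hp

lemma deriv_eq (hΩ : IsFunnel d R α L h) {s : ℝ} (hs : L * Real.cos α ≤ s) :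
    deriv h s = Real.tan α := by
  have h1 := (hΩ.differentiable s).hasDerivAt.hasDerivWithinAt (s := Ici s)
  have h2 : HasDerivWithinAt h (Real.tan α) (Ici s) s := by
    have h3 := ((hasDerivAt_id s).mul_const (Real.tan α)).hasDerivWithinAt (s := Ici s)
    rw [one_mul] at h3
    exact h3.congr (fun y hy => hΩ.right y (hs.trans hy)) (hΩ.right s hs)
  exact (uniqueDiffWithinAt_Ici s).eq_deriv _ h1 h2

lemma fderivWithin_gradRho (hΩ : IsFunnel d R α L h) (hT : 0 < Real.tan α) {g : Euc d → ℝ}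
    (hg : ContDiffOn ℝ 2 g (closure (funnel d h)))
    (hN : ∀ x ∈ frontier (funnel d h), neumannLHS h g x = 0) {x : Euc d}
    (hx : x ∈ cone d (Real.tan α)) (hL : L ≤ ‖x‖) (hρ : rho (Real.tan α) x = 0) :
    fderivWithin ℝ g (cone d (Real.tan α)) x (gradRho (Real.tan α) x) = 0 := by
  set T := Real.tan α with hTdef
  have hcos := hΩ.cos_pos
  have hxΩ := hΩ.cone_subset hT hx
  have hne : x ≠ 0 := norm_pos_iff.1 (hΩ.L_pos.trans_le hL)
  have hx0 := pos_of_mem_cone hT hx hne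
  have hpn : primeNorm x = T * x 0 := by
    have h1 := rho_eq T x
    rw [hρ] at h1
    have h2 : primeNorm x ^ 2 = (T * x 0) ^ 2 := by rw [mul_pow]; linarith
    exact (sq_eq_sq₀ (primeNorm_nonneg x) (by positivity)).1 h2
  have hle : L * Real.cos α ≤ x 0 := by
    have h1 : ‖x‖ ^ 2 = (T ^ 2 + 1) * x 0 ^ 2 := by rw [rho] at hρ; linarith
    have h2 : (T ^ 2 + 1) * Real.cos α ^ 2 = 1 := by
      have := Real.tan_mul_cos hcos.ne'
      have h7 := Real.sin_sq_add_cos_sq α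
      rw [← this] at h7
      linarith
    have h3 : (‖x‖ * Real.cos α) ^ 2 = x 0 ^ 2 := by
      rw [mul_pow, h1]
      linear_combination x 0 ^ 2 * h2
    have h4 := (sq_eq_sq₀ (by positivity) hx0.le).1 h3
    rw [← h4]
    gcongr
  have hfr : x ∈ frontier (funnel d h) := by
    refine ⟨hxΩ, fun hint => ?_⟩
    have := interior_subset hint
    simp only [funnel, mem_ofPred_eq] at this
    rw [hΩ.right _ hle, hpn] at this
    linarith
  have hD := hN x hfr
  rw [neumannLHS, hΩ.deriv_eq hle] at hD
  have hdiff := (hg.differentiableOn (by norm_num) x hxΩ).hasFDerivWithinAt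
  rw [(hdiff.mono (hΩ.cone_subset hT)).fderivWithin (uniqueDiffOn_cone hT x hx), apply_eq_sum]
  set D := fderivWithin ℝ g (closure (funnel d h)) x with hDdef
  have hpos : (0 : ℝ) < (√(1 + T ^ 2))⁻¹ := by positivity
  have h1 := (mul_eq_zero.1 hD).resolve_left hpos.ne'
  rw [Fin.sum_univ_succ] at h1 ⊢
  simp only [if_true, Fin.succ_ne_zero, if_false, zero_add, hpn] at h1
  rw [gradRho_zero_coord]
  have e : ∀ i : Fin d, gradRho T x i.succ = -2 * x i.succ := by
    intro i
    simp [gradRho, stdVec]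
  simp only [e]
  have h2 : ∑ i : Fin d, x i.succ / (T * x 0) * D (EuclideanSpace.single i.succ 1) =
      (T * x 0)⁻¹ * ∑ i : Fin d, x i.succ * D (EuclideanSpace.single i.succ 1) := by
    rw [Finset.mul_sum]
    exact Finset.sum_congr rfl fun i _ => by ring
  have h3 : ∑ i : Fin d, -2 * x i.succ * D (stdVec i.succ) =
      -2 * ∑ i : Fin d, x i.succ * D (EuclideanSpace.single i.succ 1) := by
    rw [Finset.mul_sum]
    exact Finset.sum_congr rfl fun i _ => by rw [stdVec]; ring
  rw [h2] at h1
  rw [h3]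
  have h4 : ∑ i : Fin d, x i.succ * D (EuclideanSpace.single i.succ 1) =
      T * x 0 * (T * D (EuclideanSpace.single 0 1)) := by
    field_simp at h1
    linarith
  rw [h4, stdVec]
  ring

end IsFunnel

lemma IsEntireSolution.coneSol {d : ℕ} {R α L c : ℝ} {h f φ : ℝ → ℝ} {u : ℝ → Euc d → ℝ}
    (hu : IsEntireSolution d h f c φ u) (hΩ : IsFunnel d R α L h) (hT : 0 < Real.tan α) (τ₁ : ℝ) :
    ConeSol d (Real.tan α) L f fun t => u (τ₁ + t) where
  Tpos := hT
  le_one t x hx := (hu.range01 _ x (hΩ.cone_subset hT hx)).2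
  diff x hx := (hu.time_diff x (hΩ.cone_subset hT hx)).comp (by fun_prop)
  smooth t := (hu.space_reg _).mono (hΩ.cone_subset hT)
  pde t x hx := by
    have hn := cone_mem_nhds hx
    rw [lapW_eq_lap hn, ← lapW_eq_lap (mem_of_superset hn (hΩ.cone_subset hT)),
      ← hu.pde _ x (hΩ.cone_subset hT (coneInt_subset_cone hx))]
    exact deriv_comp_const_add (fun s => u s x) τ₁ t
  lat t x hx hL hρ := hΩ.fderivWithin_gradRho hT (hu.space_reg _) (hu.neumann _) hx hL hρ

/-- At very negative times an entire solution emanating from the planar front is small to the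
right of the origin. -/
lemma IsEntireSolution.exists_le {d : ℕ} {c θ : ℝ} {h f φ : ℝ → ℝ} {u : ℝ → Euc d → ℝ}
    (hu : IsEntireSolution d h f c φ u) (hφ : PlanarFront f θ c φ) {ε : ℝ} (hε : 0 < ε) :
    ∃ τ₁, ∀ x ∈ closure (funnel d h), 0 ≤ x 0 → u τ₁ x ≤ ε := by
  obtain ⟨t₀, ht₀⟩ := hu.past (ε / 2) (by positivity)
  obtain ⟨a, ha⟩ := eventually_atTop.1 (hφ.lim_top.eventually_le_const (half_pos hε))
  have hc := hφ.cpos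
  refine ⟨min t₀ (-a / c), fun x hx hx0 => ?_⟩
  have h1 := (le_abs_self _).trans (ht₀ _ (min_le_left t₀ (-a / c)) x hx)
  have h2 : c * min t₀ (-a / c) ≤ -a := by
    have := min_le_right t₀ (-a / c)
    rw [le_div_iff₀ hc] at this
    linarith
  have h3 := ha (x 0 - c * min t₀ (-a / c)) (by linarith)
  linarith

lemma eventually_exp_neg_sqrt_le {c : ℝ} (hc : 0 < c) : ∀ᶠ τ in atTop, ∀ s ≥ 0,
    Real.exp (-c * √(s + τ)) ≤ 2 * Real.exp (-2 * varTheta s) := by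
  have h1 := (isLittleO_log_rpow_rpow_atTop ((3 : ℝ) / 2) (s := 1 / 2) (by norm_num)).def
    (show 0 < 3 * c / 4 by positivity)
  filter_upwards [eventually_forall_ge_atTop.2 h1, eventually_ge_atTop 1] with τ hτ hτ1 s hs
  have h2 := hτ (s + τ) (by linarith)
  have hS : 1 ≤ s + τ := by linarith
  have hl := Real.log_nonneg hS
  rw [Real.norm_of_nonneg (by positivity), Real.norm_of_nonneg (by positivity),
    ← Real.sqrt_eq_rpow] at h2
  have hl1 : 0 ≤ Real.log (s + 1) := Real.log_nonneg (by linarith)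
  have h3 : Real.log (s + 1) ^ ((3 : ℝ) / 2) ≤ Real.log (s + τ) ^ ((3 : ℝ) / 2) := by
    gcongr
  have h4 : Real.exp (-c * √(s + τ)) ≤ Real.exp (-2 * varTheta s) := by
    apply Real.exp_le_exp.2
    rw [varTheta]
    linarith
  have := Real.exp_pos (-2 * varTheta s)
  linarith

/-- upper bound of Lemma 4.1: in case of complete propagation, a
supersolution-type upper bound for `u` in the conical part, involving the shifted front at
position `|x| - c(t-τ₁+τ) + ((N-1)/c)·ln(t-τ₁+τ) + z₁`. -/
theorem statement15 (d : ℕ) (f φ h : ℝ → ℝ) (θ c R α L : ℝ)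
    (hf : Bistable f θ) (hφ : PlanarFront f θ c φ) (hΩ : IsFunnel d R α L h) (hα : 0 < α)
    (u : ℝ → Euc d → ℝ) (hu : IsEntireSolution d h f c φ u)
    (hprop : CompletePropagation d h u) :
    ∃ τ > (0 : ℝ), ∃ τ₁ z₁ : ℝ, ∃ δ > (0 : ℝ), ∃ μ > (0 : ℝ),
      ∀ t : ℝ, τ₁ ≤ t → ∀ x ∈ closure (funnel d h), 0 < x 0 → L ≤ ‖x‖ →
        u t x ≤
          φ (‖x‖ - c * (t - τ₁ + τ) + ((d : ℝ) / c) * Real.log (t - τ₁ + τ) + z₁)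
            + δ * Real.exp (-δ * varTheta (t - τ₁))
            + δ * Real.exp (-μ * (‖x‖ - L)) := by
  have hT : 0 < Real.tan α := Real.tan_pos_of_pos_of_lt_pi_div_two hα hΩ.αmem.2
  obtain ⟨Λ, hΛ0, hΛ⟩ := hf.exists_lipschitz
  obtain ⟨μ, hμ, K, hK, hsuper⟩ := hφ.exists_radialSuper hf d hΩ.L_pos
  obtain ⟨τ, hP, hexp, hτ⟩ := (hsuper.and ((eventually_exp_neg_sqrt_le hφ.cpos).and
    (eventually_gt_atTop 0))).exists
  obtain ⟨τ₁, hτ₁⟩ := hu.exists_le hφ (Real.exp_pos (-c * √(0 + τ)))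
  refine ⟨τ, hτ, τ₁, 0, 2, two_pos, μ, hμ, fun t ht x hx hx0 hL => ?_⟩
  have hs : 0 ≤ t - τ₁ := by linarith
  have hle := (hu.coneSol hΩ hT τ₁).le_radialSuper hP hΛ0 hΛ (fun y hy => ?_) hs
    (hΩ.mem_cone hx hx0 hL)
  · simp only [add_sub_cancel] at hle
    refine hle.trans ?_
    unfold frontSuper
    have h1 := hexp _ hs
    have h2 : φ (‖x‖ - c * (t - τ₁ + τ) + d / c * Real.log (t - τ₁ + τ) + K / √(t - τ₁ + τ)) ≤
        φ (‖x‖ - c * (t - τ₁ + τ) + d / c * Real.log (t - τ₁ + τ) + 0) := by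
      apply hφ.anti.antitone
      have : 0 ≤ K / √(t - τ₁ + τ) := by positivity
      linarith
    linarith
  · simp only [add_zero]
    refine (hτ₁ y (hΩ.cone_subset hT hy) ((mem_cone_iff hT).1 hy).1).trans ?_
    unfold frontSuper
    have h1 := (hφ.mem (‖y‖ - c * (0 + τ) + d / c * Real.log (0 + τ) + K / √(0 + τ))).1
    have h2 := Real.exp_pos (-μ * (‖y‖ - L))
    linarith

end
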